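/- Every cap in the 7-dimensional affine space over the field of three elements has size at most 288; in particular, there are no 289-cap 7-flats. -/

import Mathlib

/-- A cap in the `n`-dimensional affine space over the field of three elements:
a finite set of points, no three distinct ones of which lie on a common line
(equivalently, no three pairwise distinct points sum to zero). -/
def IsCap {n : ℕ} (S : Finset (Fin n → ZMod 3)) : Prop :=
  ∀ a ∈ S, ∀ b ∈ S, ∀ c ∈ S, a ≠ b → a ≠ c → b ≠ c → a + b + c ≠ 0

section Certificates

/- Kernel evaluation of the certificate checks is much faster on the bare operations of `ℕ` than
on the overloaded ones. -/
local infixl:65 "∔" => Nat.add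
local infixl:65 "∸" => Nat.sub
local infixl:70 "∗" => Nat.mul

/-- The point counts of a cap on the nine cells cut out by two independent functionals. -/
structure Grid where
  (a0 a1 a2 b0 b1 b2 c0 c1 c2 : ℕ)

/-- Coefficients of a linear inequality between the quadratic and cubic statistics of a grid. -/
structure Cert where
  (A B C D E F k K : ℤ)

/-- The sum of the squares of three numbers. -/
def sumSq (x y z : ℕ) : ℕ := x ∗ x ∔ y ∗ y ∔ z ∗ z

/-- The number of zero-sum triples with entries in a multiset on `ZMod 3` with multiplicities
`x`, `y`, `z`. -/
def tri (x y z : ℕ) : ℕ := x ∗ x ∗ x ∔ y ∗ y ∗ y ∔ z ∗ z ∗ z ∔ 6 ∗ (x ∗ y ∗ z)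

/-- The number of zero-sum triples with one entry in each of three multisets on `ZMod 3`. -/
def mix (x y z x' y' z' u v w : ℕ) : ℕ :=
  u ∗ (x ∗ x' ∔ y ∗ z' ∔ z ∗ y') ∔ v ∗ (x ∗ z' ∔ z ∗ x' ∔ y ∗ y') ∔
    w ∗ (x ∗ y' ∔ y ∗ x' ∔ z ∗ z')

/-- A symmetric test on triples: all entries are at most `M`, and `t` holds for the sum, the sum
of squares and the product. -/
def ok (M : ℕ) (t : ℕ → ℕ → ℕ → Bool) (x y z : ℕ) : Bool :=
  Nat.ble x M && (Nat.ble y M && (Nat.ble z M && t (x ∔ y ∔ z) (sumSq x y z) (x ∗ y ∗ z)))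

/-- The three directions of hyperplanes transversal to the rows of the grid pass `ok M t`. -/
def Grid.dirs (M : ℕ) (t : ℕ → ℕ → ℕ → Bool) (G : Grid) : Bool :=
  ok M t (G.a0 ∔ G.b0 ∔ G.c0) (G.a1 ∔ G.b1 ∔ G.c1) (G.a2 ∔ G.b2 ∔ G.c2) &&
  (ok M t (G.a0 ∔ G.b1 ∔ G.c2) (G.a1 ∔ G.b2 ∔ G.c0) (G.a2 ∔ G.b0 ∔ G.c1) &&
   ok M t (G.a0 ∔ G.b2 ∔ G.c1) (G.a1 ∔ G.b0 ∔ G.c2) (G.a2 ∔ G.b1 ∔ G.c0))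

/-- All twelve lines of the grid pass the test `ok M t`. -/
def Grid.lines (M : ℕ) (t : ℕ → ℕ → ℕ → Bool) (G : Grid) : Bool :=
  ok M t G.a0 G.a1 G.a2 && (ok M t G.b0 G.b1 G.b2 && (ok M t G.c0 G.c1 G.c2 &&
  (ok M t G.a0 G.b0 G.c0 && (ok M t G.a1 G.b1 G.c1 && (ok M t G.a2 G.b2 G.c2 &&
  (ok M t G.a0 G.b1 G.c2 && (ok M t G.a1 G.b2 G.c0 && (ok M t G.a2 G.b0 G.c1 &&
  (ok M t G.a0 G.b2 G.c1 && (ok M t G.a1 G.b0 G.c2 && ok M t G.a2 G.b1 G.c0))))))))))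

/-- The linear statistic of a grid attached to a certificate. -/
def Cert.lin (c : Cert) (G : Grid) : ℤ :=
  c.A * sumSq G.a0 G.a1 G.a2 + c.B * sumSq G.b0 G.b1 G.b2 + c.C * sumSq G.c0 G.c1 G.c2 +
  c.D * tri G.a0 G.a1 G.a2 + c.E * tri G.b0 G.b1 G.b2 + c.F * tri G.c0 G.c1 G.c2 +
  c.k * mix G.a0 G.a1 G.a2 G.b0 G.b1 G.b2 G.c0 G.c1 G.c2

/-- The contribution of a row to the statistic of a grid. -/
def rowStat (α β x y z : ℕ) : ℕ := α ∗ sumSq x y z ∔ β ∗ tri x y z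

/-- The positive part of the statistic of the first two rows. -/
def Cert.pos (c : Cert) (x y z x' y' z' : ℕ) : ℕ :=
  rowStat c.A.toNat c.D.toNat x y z ∔ rowStat c.B.toNat c.E.toNat x' y' z' ∔ (-c.K).toNat

/-- The negative part of the statistic of the first two rows. -/
def Cert.neg (c : Cert) (x y z x' y' z' : ℕ) : ℕ :=
  rowStat (-c.A).toNat (-c.D).toNat x y z ∔ rowStat (-c.B).toNat (-c.E).toNat x' y' z' ∔ c.K.toNat

/-- The positive part of the statistic of a grid. -/
def Cert.gridPos (c : Cert) (G : Grid) : ℕ :=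
  c.pos G.a0 G.a1 G.a2 G.b0 G.b1 G.b2 ∔ rowStat c.C.toNat c.F.toNat G.c0 G.c1 G.c2 ∔
    c.k.toNat ∗ mix G.a0 G.a1 G.a2 G.b0 G.b1 G.b2 G.c0 G.c1 G.c2

/-- The negative part of the statistic of a grid. -/
def Cert.gridNeg (c : Cert) (G : Grid) : ℕ :=
  c.neg G.a0 G.a1 G.a2 G.b0 G.b1 G.b2 ∔ rowStat (-c.C).toNat (-c.F).toNat G.c0 G.c1 G.c2 ∔
    (-c.k).toNat ∗ mix G.a0 G.a1 G.a2 G.b0 G.b1 G.b2 G.c0 G.c1 G.c2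

/-- Test whether every completion of two rows satisfies the inequality strictly, by bounding
a quadratic polynomial in the third row from below. -/
def Cert.skip (c : Cert) (p q r x y z x' y' z' : ℕ) : Bool :=
  Nat.beq (c.F.natAbs ∔ (-c.C).toNat ∔ (-c.k).toNat) 0 &&
  Nat.blt (24 ∗ c.C.toNat ∗ c.neg x y z x' y' z' ∔
      c.k.toNat ∗ c.k.toNat ∗ ((3 ∗ sumSq x y z ∸ p ∗ p) ∗ (3 ∗ sumSq x' y' z' ∸ q ∗ q)))
    (24 ∗ c.C.toNat ∗ c.pos x y z x' y' z' ∔ 8 ∗ c.C.toNat ∗ c.C.toNat ∗ (r ∗ r) ∔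
      8 ∗ c.C.toNat ∗ c.k.toNat ∗ (p ∗ q ∗ r))

/-- An admissible grid has large statistic, and if it is minimal then `t'` holds. -/
def Cert.gridOK (c : Cert) (M₁ M₂ : ℕ) (s t t' : ℕ → ℕ → ℕ → Bool) (G : Grid) : Bool :=
  Nat.blt (c.gridNeg G) (c.gridPos G) || (!(G.lines M₁ s && G.dirs M₂ t) ||
    (Nat.ble (c.gridNeg G) (c.gridPos G) && G.dirs M₂ t'))

/-- `p` holds for all numbers less than `n`. -/
noncomputable def allLT (n : ℕ) (p : ℕ → Bool) : Bool := Nat.rec true (fun k ih => p k && ih) n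

/-- `p` holds for all nondecreasing triples with sum `s`. -/
noncomputable def sortedRows (s : ℕ) (p : ℕ → ℕ → ℕ → Bool) : Bool :=
  allLT (s / 3 ∔ 1) fun x => allLT ((s ∸ 3 ∗ x) / 2 ∔ 1) fun u => p x (x ∔ u) (s ∸ 2 ∗ x ∸ u)

/-- `p` holds for all triples with sum `s` whose first entry is minimal. -/
noncomputable def minRows (s : ℕ) (p : ℕ → ℕ → ℕ → Bool) : Bool :=
  allLT (s / 3 ∔ 1) fun x => allLT (s ∸ 3 ∗ x ∔ 1) fun u => p x (x ∔ u) (s ∸ 2 ∗ x ∸ u)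

/-- `p` holds for all triples with sum `s` in a box. -/
noncomputable def boxRows (s X Y Z : ℕ) (p : ℕ → ℕ → ℕ → Bool) : Bool :=
  allLT (X ∔ 1 ∸ (X ∸ s) ∸ (s ∸ Y ∸ Z)) fun v =>
    allLT (Y ∔ 1 ∸ (Y ∸ (s ∸ (s ∸ Y ∸ Z ∔ v))) ∸ (s ∸ (s ∸ Y ∸ Z ∔ v) ∸ Z)) fun w =>
      p (s ∸ Y ∸ Z ∔ v) (s ∸ (s ∸ Y ∸ Z ∔ v) ∸ Z ∔ w)
        (s ∸ (s ∸ Y ∸ Z ∔ v) ∸ (s ∸ (s ∸ Y ∸ Z ∔ v) ∸ Z ∔ w))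

/-- The largest `u ≤ M₁` for which `x + u`, `y + u` and `z + u` can be at most `M₂`. -/
def room (M₁ M₂ x y z : ℕ) : ℕ := M₁ ∸ (M₁ ∸ (M₂ ∸ (x ∔ (y ∔ (z ∸ y) ∸ x))))

/-- All grids with row sums `p`, `q`, `r` in normal form pass `Cert.gridOK`. -/
noncomputable def Cert.gridCheck (c : Cert) (M₁ M₂ : ℕ) (s t t' : ℕ → ℕ → ℕ → Bool)
    (p q r : ℕ) : Bool :=
  sortedRows p fun x y z => !ok M₁ s x y z || minRows q fun x' y' z' =>
    !ok M₁ s x' y' z' || (c.skip p q r x y z x' y' z' ||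
      boxRows r (room M₁ M₂ (x ∔ x') (y ∔ z') (z ∔ y')) (room M₁ M₂ (x ∔ z') (z ∔ x') (y ∔ y'))
        (room M₁ M₂ (x ∔ y') (y ∔ x') (z ∔ z')) fun u v w =>
          c.gridOK M₁ M₂ s t t' ⟨x, y, z, x', y', z', u, v, w⟩)

lemma sumSq_eq (x y z : ℕ) : sumSq x y z = x * x + y * y + z * z := rfl

lemma tri_eq (x y z : ℕ) : tri x y z = x * x * x + y * y * y + z * z * z + 6 * (x * y * z) := rfl

lemma mix_eq (x y z x' y' z' u v w : ℕ) : mix x y z x' y' z' u v w =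
    u * (x * x' + y * z' + z * y') + v * (x * z' + z * x' + y * y') +
      w * (x * y' + y * x' + z * z') := rfl

lemma rowStat_eq (α β x y z : ℕ) : rowStat α β x y z = α * sumSq x y z + β * tri x y z := rfl

lemma ok_iff {M : ℕ} {t : ℕ → ℕ → ℕ → Bool} {x y z : ℕ} : ok M t x y z = true ↔
    x ≤ M ∧ y ≤ M ∧ z ≤ M ∧ t (x + y + z) (sumSq x y z) (x * y * z) = true := by
  simp [ok]

lemma ok_rot {M : ℕ} {t : ℕ → ℕ → ℕ → Bool} {x y z : ℕ} (h : ok M t x y z = true) :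
    ok M t y z x = true := by
  rw [ok_iff] at *
  refine ⟨h.2.1, h.2.2.1, h.1, ?_⟩
  rw [← h.2.2.2, sumSq_eq, sumSq_eq]
  congr 1 <;> ring

lemma ok_swap {M : ℕ} {t : ℕ → ℕ → ℕ → Bool} {x y z : ℕ} (h : ok M t x y z = true) :
    ok M t x z y = true := by
  rw [ok_iff] at *
  refine ⟨h.1, h.2.2.1, h.2.1, ?_⟩
  rw [← h.2.2.2, sumSq_eq, sumSq_eq]
  congr 1 <;> ring

lemma allLT_spec {n : ℕ} {p : ℕ → Bool} (h : allLT n p = true) {k : ℕ} (hk : k < n) :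
    p k = true := by
  induction n with
  | zero => omega
  | succ n ih =>
    have h' : (p n && allLT n p) = true := h
    rw [Bool.and_eq_true] at h'
    rcases Nat.lt_succ_iff_lt_or_eq.1 hk with h1 | rfl
    · exact ih h'.2 h1
    · exact h'.1

lemma sortedRows_spec {s : ℕ} {p : ℕ → ℕ → ℕ → Bool} (h : sortedRows s p = true) {x y z : ℕ}
    (hs : x + y + z = s) (hxy : x ≤ y) (hyz : y ≤ z) : p x y z = true := by
  have h1 : x < (s / 3).add 1 := by simp only [Nat.add_eq]; omega
  have h2 : y - x < ((s.sub (Nat.mul 3 x)) / 2).add 1 := by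
    simp only [Nat.add_eq, Nat.sub_eq, Nat.mul_eq]; omega
  convert allLT_spec (allLT_spec h h1) h2 using 1
  simp only [Nat.add_eq, Nat.sub_eq, Nat.mul_eq]
  congr 1 <;> omega

lemma minRows_spec {s : ℕ} {p : ℕ → ℕ → ℕ → Bool} (h : minRows s p = true) {x y z : ℕ}
    (hs : x + y + z = s) (hxy : x ≤ y) (hxz : x ≤ z) : p x y z = true := by
  have h1 : x < (s / 3).add 1 := by simp only [Nat.add_eq]; omega
  have h2 : y - x < (s.sub (Nat.mul 3 x)).add 1 := by
    simp only [Nat.add_eq, Nat.sub_eq, Nat.mul_eq]; omega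
  convert allLT_spec (allLT_spec h h1) h2 using 1
  simp only [Nat.add_eq, Nat.sub_eq, Nat.mul_eq]
  congr 1 <;> omega

lemma boxRows_spec {s X Y Z : ℕ} {p : ℕ → ℕ → ℕ → Bool} (h : boxRows s X Y Z p = true)
    {x y z : ℕ} (hs : x + y + z = s) (hx : x ≤ X) (hy : y ≤ Y) (hz : z ≤ Z) :
    p x y z = true := by
  have e1 : s - Y - Z + (x - (s - Y - Z)) = x := by omega
  have h1 : x - (s - Y - Z) < ((X.add 1).sub (X.sub s)).sub ((s.sub Y).sub Z) := by
    simp only [Nat.add_eq, Nat.sub_eq]; omega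
  have h := allLT_spec h h1
  simp only [Nat.add_eq, Nat.sub_eq, e1] at h
  have h2 : y - (s - x - Z) < Y + 1 - (Y - (s - x)) - (s - x - Z) := by omega
  convert allLT_spec h h2 using 1
  congr 1 <;> omega

lemma le_room {M₁ M₂ x y z u : ℕ} (h : u ≤ M₁) (hx : x + u ≤ M₂) (hy : y + u ≤ M₂)
    (hz : z + u ≤ M₂) : u ≤ room M₁ M₂ x y z := by
  simp only [room, Nat.add_eq, Nat.sub_eq]
  omega

lemma Cert.gridPos_sub_gridNeg (c : Cert) (G : Grid) :
    (c.gridPos G : ℤ) - c.gridNeg G = c.lin G - c.K := by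
  simp only [gridPos, gridNeg, pos, neg, lin, rowStat, Nat.add_eq, Nat.mul_eq]
  have h := fun z : ℤ => Int.toNat_sub_toNat_neg z
  push_cast only [Nat.cast_add, Nat.cast_mul]
  linear_combination (sumSq G.a0 G.a1 G.a2 : ℤ) * h c.A + (sumSq G.b0 G.b1 G.b2 : ℤ) * h c.B +
    (sumSq G.c0 G.c1 G.c2 : ℤ) * h c.C + (tri G.a0 G.a1 G.a2 : ℤ) * h c.D +
    (tri G.b0 G.b1 G.b2 : ℤ) * h c.E + (tri G.c0 G.c1 G.c2 : ℤ) * h c.F +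
    (mix G.a0 G.a1 G.a2 G.b0 G.b1 G.b2 G.c0 G.c1 G.c2 : ℤ) * h c.k - h c.K

/-- Completing the square in the third row, in terms of the Fourier transform on `ZMod 3`. -/
lemma quadratic_bound (C k a0 a1 a2 b0 b1 b2 c0 c1 c2 : ℤ) :
    0 ≤ 24 * C * (C * (c0 * c0 + c1 * c1 + c2 * c2) +
        k * (c0 * (a0 * b0 + a1 * b2 + a2 * b1) + c1 * (a0 * b2 + a2 * b0 + a1 * b1) +
          c2 * (a0 * b1 + a1 * b0 + a2 * b2))) +
      k * k * ((3 * (a0 * a0 + a1 * a1 + a2 * a2) - (a0 + a1 + a2) * (a0 + a1 + a2)) *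
        (3 * (b0 * b0 + b1 * b1 + b2 * b2) - (b0 + b1 + b2) * (b0 + b1 + b2))) -
      8 * C * C * ((c0 + c1 + c2) * (c0 + c1 + c2)) -
      8 * C * k * ((a0 + a1 + a2) * (b0 + b1 + b2) * (c0 + c1 + c2)) := by
  obtain ⟨U, hU⟩ : ∃ U, U = 2 * C * (c0 - c1) +
    k * ((a0 - a2) * (b0 - b2) - (a1 - a2) * (b1 - b2)) := ⟨_, rfl⟩
  obtain ⟨W, hW⟩ : ∃ W, W = -2 * C * (c1 - c2) + k * ((a0 - a2) * (b1 - b2) +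
    (a1 - a2) * (b0 - b2) - (a1 - a2) * (b1 - b2)) := ⟨_, rfl⟩
  have h : 0 ≤ (2 * U - W) * (2 * U - W) + 3 * (W * W) := by
    nlinarith [mul_self_nonneg (2 * U - W), mul_self_nonneg W]
  convert h using 1
  rw [hU, hW]
  ring

lemma sq_sum_le_sumSq (x y z : ℕ) : (x + y + z) * (x + y + z) ≤ 3 * sumSq x y z := by
  rw [sumSq_eq]
  zify
  nlinarith [mul_self_nonneg ((x : ℤ) - y), mul_self_nonneg ((x : ℤ) - z),
    mul_self_nonneg ((y : ℤ) - z)]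

lemma Cert.lt_lin_of_skip {c : Cert} {G : Grid}
    (h : c.skip (G.a0 + G.a1 + G.a2) (G.b0 + G.b1 + G.b2) (G.c0 + G.c1 + G.c2)
      G.a0 G.a1 G.a2 G.b0 G.b1 G.b2 = true) : c.K < c.lin G := by
  simp only [skip, Bool.and_eq_true, Nat.beq_eq, Nat.blt_eq, Nat.add_eq, Nat.mul_eq,
    Nat.sub_eq] at h
  obtain ⟨h0, h⟩ := h
  have hF : c.F = 0 := by omega
  have hC : (c.C.toNat : ℤ) = c.C := by omega
  have hk : (c.k.toNat : ℤ) = c.k := by omega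
  have hlin := c.gridPos_sub_gridNeg G
  have hC' : (-c.C).toNat = 0 := by omega
  have hk' : (-c.k).toNat = 0 := by omega
  simp only [gridPos, gridNeg, rowStat, hF, hC', hk', Nat.add_eq, Nat.mul_eq, Nat.cast_add,
    Nat.cast_mul, hC, hk, Int.toNat_zero, neg_zero, zero_mul, add_zero] at hlin
  zify [sq_sum_le_sumSq] at h
  rw [hC, hk] at h
  have hb := quadratic_bound c.C c.k G.a0 G.a1 G.a2 G.b0 G.b1 G.b2 G.c0 G.c1 G.c2
  simp only [sumSq_eq, mix_eq] at h hlin hb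
  push_cast at h hlin hb
  have hpos : 0 < 24 * c.C * (c.lin G - c.K) := by
    rw [← hlin]
    linear_combination h + hb
  have hC0 : 0 ≤ 24 * c.C := by omega
  exact sub_pos.1 (pos_of_mul_pos_right hpos hC0)

/-- The first row of the grid rotated. -/
def Grid.rotA (G : Grid) : Grid :=
  ⟨G.a1, G.a2, G.a0, G.b0, G.b1, G.b2, G.c2, G.c0, G.c1⟩

/-- The second row of the grid rotated. -/
def Grid.rotB (G : Grid) : Grid :=
  ⟨G.a0, G.a1, G.a2, G.b1, G.b2, G.b0, G.c2, G.c0, G.c1⟩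

/-- The grid with all rows reflected. -/
def Grid.refl (G : Grid) : Grid :=
  ⟨G.a0, G.a2, G.a1, G.b0, G.b2, G.b1, G.c0, G.c2, G.c1⟩

/-- What a certificate is required to imply about a grid. -/
def Cert.Good (c : Cert) (M₁ M₂ : ℕ) (s t t' : ℕ → ℕ → ℕ → Bool) (p q r : ℕ) (G : Grid) : Prop :=
  G.lines M₁ s = true → G.dirs M₂ t = true → G.a0 + G.a1 + G.a2 = p → G.b0 + G.b1 + G.b2 = q →
    G.c0 + G.c1 + G.c2 = r → c.K ≤ c.lin G ∧ (c.lin G = c.K → G.dirs M₂ t' = true)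

variable {c : Cert} {M M₁ M₂ : ℕ} {s t t' : ℕ → ℕ → ℕ → Bool} {p q r : ℕ} {G : Grid}

lemma Grid.lines_rotA (h : G.lines M t = true) : G.rotA.lines M t = true := by
  simp only [lines, rotA, Bool.and_eq_true] at *
  obtain ⟨h1, h2, h3, h4, h5, h6, h7, h8, h9, h10, h11, h12⟩ := h
  exact ⟨ok_rot h1, h2, ok_rot (ok_rot h3), h11, h12, h10, h5, h6, h4, h8, h9, h7⟩

lemma Grid.lines_rotB (h : G.lines M t = true) : G.rotB.lines M t = true := by
  simp only [lines, rotB, Bool.and_eq_true] at *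
  obtain ⟨h1, h2, h3, h4, h5, h6, h7, h8, h9, h10, h11, h12⟩ := h
  exact ⟨h1, ok_rot h2, ok_rot (ok_rot h3), h7, h8, h9, h10, h11, h12, h4, h5, h6⟩

lemma Grid.lines_refl (h : G.lines M t = true) : G.refl.lines M t = true := by
  simp only [lines, refl, Bool.and_eq_true] at *
  obtain ⟨h1, h2, h3, h4, h5, h6, h7, h8, h9, h10, h11, h12⟩ := h
  exact ⟨ok_swap h1, ok_swap h2, ok_swap h3, h4, h6, h5, h10, h12, h11, h7, h9, h8⟩

lemma Grid.dirs_rotA (h : G.dirs M t = true) : G.rotA.dirs M t = true := by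
  simp only [dirs, rotA, Bool.and_eq_true] at *
  obtain ⟨h1, h2, h3⟩ := h
  exact ⟨ok_rot h3, ok_rot h1, ok_rot h2⟩

lemma Grid.dirs_rotB (h : G.dirs M t = true) : G.rotB.dirs M t = true := by
  simp only [dirs, rotB, Bool.and_eq_true] at *
  obtain ⟨h1, h2, h3⟩ := h
  exact ⟨h2, h3, h1⟩

lemma Grid.dirs_refl (h : G.dirs M t = true) : G.refl.dirs M t = true := by
  simp only [dirs, refl, Bool.and_eq_true] at *
  obtain ⟨h1, h2, h3⟩ := h
  exact ⟨ok_swap h1, ok_swap h3, ok_swap h2⟩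

lemma Cert.lin_rotA (c : Cert) (G : Grid) : c.lin G.rotA = c.lin G := by
  simp only [lin, Grid.rotA, sumSq_eq, tri_eq, mix_eq]
  push_cast
  ring

lemma Cert.lin_rotB (c : Cert) (G : Grid) : c.lin G.rotB = c.lin G := by
  simp only [lin, Grid.rotB, sumSq_eq, tri_eq, mix_eq]
  push_cast
  ring

lemma Cert.lin_refl (c : Cert) (G : Grid) : c.lin G.refl = c.lin G := by
  simp only [lin, Grid.refl, sumSq_eq, tri_eq, mix_eq]
  push_cast
  ring

lemma Cert.Good.of_rotA (h : c.Good M₁ M₂ s t t' p q r G.rotA) :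
    c.Good M₁ M₂ s t t' p q r G := by
  intro h1 h2 h3 h4 h5
  have := h (Grid.lines_rotA h1) (Grid.dirs_rotA h2) (by simp only [Grid.rotA]; omega) h4
    (by simp only [Grid.rotA]; omega)
  rw [c.lin_rotA] at this
  exact ⟨this.1, fun e => Grid.dirs_rotA (Grid.dirs_rotA (this.2 e))⟩

lemma Cert.Good.of_rotB (h : c.Good M₁ M₂ s t t' p q r G.rotB) :
    c.Good M₁ M₂ s t t' p q r G := by
  intro h1 h2 h3 h4 h5
  have := h (Grid.lines_rotB h1) (Grid.dirs_rotB h2) h3 (by simp only [Grid.rotB]; omega)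
    (by simp only [Grid.rotB]; omega)
  rw [c.lin_rotB] at this
  exact ⟨this.1, fun e => Grid.dirs_rotB (Grid.dirs_rotB (this.2 e))⟩

lemma Cert.Good.of_refl (h : c.Good M₁ M₂ s t t' p q r G.refl) :
    c.Good M₁ M₂ s t t' p q r G := by
  intro h1 h2 h3 h4 h5
  have := h (Grid.lines_refl h1) (Grid.dirs_refl h2) (by simp only [Grid.refl]; omega)
    (by simp only [Grid.refl]; omega) (by simp only [Grid.refl]; omega)
  rw [c.lin_refl] at this
  exact ⟨this.1, fun e => Grid.dirs_refl (this.2 e)⟩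

lemma Cert.Good.of_sorted (h : c.gridCheck M₁ M₂ s t t' p q r = true)
    (h01 : G.a0 ≤ G.a1) (h12 : G.a1 ≤ G.a2) (hb1 : G.b0 ≤ G.b1) (hb2 : G.b0 ≤ G.b2) :
    c.Good M₁ M₂ s t t' p q r G := by
  intro hl hd hp hq hr
  have hl' := hl
  have hd' := hd
  simp only [Grid.lines, Grid.dirs, Bool.and_eq_true] at hl' hd'
  have h := sortedRows_spec h hp h01 h12
  rw [hl'.1, Bool.not_true, Bool.false_or] at h
  have h := minRows_spec h hq hb1 hb2
  rw [hl'.2.1, Bool.not_true, Bool.false_or, Bool.or_eq_true] at h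
  rcases h with h | h
  · rw [← hp, ← hq, ← hr] at h
    have := Cert.lt_lin_of_skip h
    exact ⟨this.le, fun e => absurd e this.ne'⟩
  · simp only [ok_iff, Nat.add_eq] at hl' hd'
    have h := boxRows_spec h hr
      (le_room (by omega) (by simp only [Nat.add_eq]; omega) (by simp only [Nat.add_eq]; omega)
        (by simp only [Nat.add_eq]; omega))
      (le_room (by omega) (by simp only [Nat.add_eq]; omega) (by simp only [Nat.add_eq]; omega)
        (by simp only [Nat.add_eq]; omega))
      (le_room (by omega) (by simp only [Nat.add_eq]; omega) (by simp only [Nat.add_eq]; omega)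
        (by simp only [Nat.add_eq]; omega))
    have hlin := c.gridPos_sub_gridNeg G
    change c.gridOK M₁ M₂ s t t' G = true at h
    simp only [gridOK, hl, hd, Bool.and_self, Bool.not_true, Bool.false_or, Bool.or_eq_true,
      Bool.and_eq_true, Nat.blt_eq, Nat.ble_eq] at h
    rcases h with h | h
    · exact ⟨by omega, fun e => by omega⟩
    · exact ⟨by omega, fun _ => h.2⟩

lemma Cert.good_of_gridCheck (h : c.gridCheck M₁ M₂ s t t' p q r = true) (G : Grid) :
    c.Good M₁ M₂ s t t' p q r G := by
  have h1 : ∀ G : Grid, G.a0 ≤ G.a1 → G.a1 ≤ G.a2 → c.Good M₁ M₂ s t t' p q r G := by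
    intro G h01 h12
    by_cases hb : G.b0 ≤ G.b1 ∧ G.b0 ≤ G.b2
    · exact .of_sorted h h01 h12 hb.1 hb.2
    · by_cases hb' : G.b1 ≤ G.b2
      · exact .of_rotB (.of_sorted h h01 h12 hb' (by simp only [Grid.rotB]; omega))
      · refine .of_rotB (.of_rotB (.of_sorted h h01 h12 ?_ ?_)) <;>
          simp only [Grid.rotB] <;> omega
  have h2 : ∀ G : Grid, G.a0 ≤ G.a1 → G.a0 ≤ G.a2 → c.Good M₁ M₂ s t t' p q r G := by
    intro G h01 h02
    rcases le_total G.a1 G.a2 with h12 | h12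
    · exact h1 G h01 h12
    · exact .of_refl (h1 _ h02 h12)
  by_cases ha : G.a0 ≤ G.a1 ∧ G.a0 ≤ G.a2
  · exact h2 G ha.1 ha.2
  · by_cases ha' : G.a1 ≤ G.a2
    · exact .of_rotA (h2 _ ha' (by simp only [Grid.rotA]; omega))
    · refine .of_rotA (.of_rotA (h2 _ ?_ ?_)) <;> simp only [Grid.rotA] <;> omega

end Certificates

section CapBounds

open Module

section LinearAlgebra

set_option linter.unusedSectionVars false

variable {V : Type} [AddCommGroup V] [Module (ZMod 3) V] [Finite V]

noncomputable instance : Fintype (Dual (ZMod 3) V) :=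
  haveI : Finite (Dual (ZMod 3) V) := Module.finite_of_finite (ZMod 3)
  Fintype.ofFinite _

/-- A subset of a vector space over the field of three elements without affine lines. -/
def LineFree (S : Finset V) : Prop :=
  ∀ x ∈ S, ∀ y ∈ S, ∀ z ∈ S, x + y + z = 0 → x = y ∧ y = z

/-- The number of points of `S` on the hyperplane `f = i`. -/
noncomputable def cnt (S : Finset V) (f : Dual (ZMod 3) V) (i : ZMod 3) : ℕ :=
  (S.filter (fun x => f x = i)).card

lemma card_dual {n : ℕ} (hn : finrank (ZMod 3) V = n) :
    Fintype.card (Dual (ZMod 3) V) = 3 ^ n := by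
  rw [Module.card_eq_pow_finrank (K := ZMod 3), Subspace.dual_finrank_eq, hn, ZMod.card]

lemma card_vanish {n : ℕ} (hn : finrank (ZMod 3) V = n + 1) {z : V} (hz : z ≠ 0) :
    (Finset.univ.filter (fun g : Dual (ZMod 3) V => g z = 0)).card = 3 ^ n := by
  classical
  let ev : Dual (ZMod 3) V →ₗ[ZMod 3] ZMod 3 := Dual.eval (ZMod 3) V z
  have hs : LinearMap.range ev = ⊤ := by
    rw [LinearMap.range_eq_top]
    refine LinearMap.surjective fun h => hz ?_
    exact (Module.forall_dual_apply_eq_zero_iff (ZMod 3) z).1 fun g => by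
      simpa [ev] using LinearMap.congr_fun h g
  have h1 := LinearMap.finrank_range_add_finrank_ker ev
  rw [hs, finrank_top, finrank_self, Subspace.dual_finrank_eq, hn] at h1
  have h2 : Nat.card (LinearMap.ker ev) = 3 ^ n := by
    rw [Module.natCard_eq_pow_finrank (K := ZMod 3), Nat.card_zmod]
    congr 1; omega
  rw [← h2, Nat.card_eq_fintype_card, Fintype.card_subtype]
  congr 1; ext g; simp [ev]

lemma sum_card_vanish {ι : Type*} {n : ℕ} (hn : finrank (ZMod 3) V = n + 1)
    [DecidableEq V] (I : Finset ι) (φ : ι → V) :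
    ∑ g : Dual (ZMod 3) V, (I.filter (fun p => g (φ p) = 0)).card =
      3 ^ n * (I.card + 2 * (I.filter (fun p => φ p = 0)).card) := by
  simp only [Finset.card_filter]
  rw [Finset.sum_comm]
  have : ∀ p ∈ I, (∑ g : Dual (ZMod 3) V, if g (φ p) = 0 then 1 else 0) =
      3 ^ n * (1 + 2 * if φ p = 0 then 1 else 0) := by
    intro p _
    rw [← Finset.card_filter]
    by_cases h : φ p = 0
    · simp [h, card_dual hn, pow_succ]
    · simp [h, card_vanish hn h]
  rw [Finset.sum_congr rfl this, ← Finset.mul_sum, Finset.sum_add_distrib, ← Finset.mul_sum]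
  simp

/-- The functionals which are not multiples of `f`. -/
noncomputable def indep (f : Dual (ZMod 3) V) : Finset (Dual (ZMod 3) V) := by
  classical exact Finset.univ \ {0, f, -f}

lemma mem_indep {f g : Dual (ZMod 3) V} : g ∈ indep f ↔ g ≠ 0 ∧ g ≠ f ∧ g ≠ -f := by
  simp [indep]

lemma neg_ne_self_dual {f : Dual (ZMod 3) V} (hf : f ≠ 0) : f ≠ -f := by
  intro h
  apply hf
  ext x
  have := LinearMap.congr_fun h x
  simp only [LinearMap.neg_apply] at this
  simp only [LinearMap.zero_apply]
  generalize f x = a at *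
  revert a; decide

lemma sum_indep {f : Dual (ZMod 3) V} (hf : f ≠ 0) (F : Dual (ZMod 3) V → ℕ) :
    ∑ g ∈ indep f, F g + (F 0 + F f + F (-f)) = ∑ g, F g := by
  classical
  have h : ∑ g ∈ ({0, f, -f} : Finset (Dual (ZMod 3) V)), F g = F 0 + F f + F (-f) := by
    rw [Finset.sum_insert, Finset.sum_insert, Finset.sum_singleton, add_assoc]
    · simpa using neg_ne_self_dual hf
    · simp only [Finset.mem_insert, Finset.mem_singleton, not_or]
      exact ⟨hf.symm, fun h => hf (by simpa using h.symm)⟩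
  rw [← h, indep]
  convert Finset.sum_sdiff (Finset.subset_univ _)

lemma card_indep {n : ℕ} (hn : finrank (ZMod 3) V = n + 1) {f : Dual (ZMod 3) V} (hf : f ≠ 0) :
    (indep f).card + 3 = 3 * 3 ^ n := by
  have := sum_indep hf (fun _ => 1)
  simp only [Finset.sum_const, smul_eq_mul, mul_one, Finset.card_univ, card_dual hn] at this
  rw [this, pow_succ, mul_comm]

lemma sum_indep_card_vanish {ι : Type*} {n : ℕ} (hn : finrank (ZMod 3) V = n + 1)
    [DecidableEq V] {f : Dual (ZMod 3) V} (hf : f ≠ 0) (I : Finset ι) (φ : ι → V)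
    (h : ∀ p ∈ I, f (φ p) = 0) :
    ∑ g ∈ indep f, (I.filter (fun p => g (φ p) = 0)).card + 3 * I.card =
      3 ^ n * (I.card + 2 * (I.filter (fun p => φ p = 0)).card) := by
  rw [← sum_card_vanish hn, ← sum_indep hf]
  congr 1
  have h1 : I.filter (fun p => f (φ p) = 0) = I := Finset.filter_true_of_mem h
  simp [h1]
  ring

lemma sum_fiber (A : Finset V) (g : Dual (ZMod 3) V) (F : ZMod 3 → ℕ) :
    ∑ x ∈ A, F (g x) = cnt A g 0 * F 0 + cnt A g 1 * F 1 + cnt A g 2 * F 2 := by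
  rw [← Finset.sum_fiberwise_of_maps_to (s := A) (t := Finset.univ) (g := g)
    (fun x _ => Finset.mem_univ _) (fun x => F (g x))]
  have : ∀ j ∈ (Finset.univ : Finset (ZMod 3)),
      ∑ x ∈ A with g x = j, F (g x) = cnt A g j * F j := by
    intro j _
    rw [Finset.sum_congr rfl (g := fun _ => F j), Finset.sum_const, smul_eq_mul]; · rfl
    intro x hx; rw [(Finset.mem_filter.1 hx).2]
  rw [Finset.sum_congr rfl this]
  exact Fin.sum_univ_three (fun j : ZMod 3 => cnt A g j * F j)

lemma cnt_add (A : Finset V) (g : Dual (ZMod 3) V) :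
    cnt A g 0 + cnt A g 1 + cnt A g 2 = A.card := by
  have := sum_fiber A g (fun _ => 1)
  simpa using this.symm

lemma card_pairs_vanish (A : Finset V) (g : Dual (ZMod 3) V) :
    ((A ×ˢ A).filter (fun p => g (p.1 - p.2) = 0)).card =
      cnt A g 0 * cnt A g 0 + cnt A g 1 * cnt A g 1 + cnt A g 2 * cnt A g 2 := by
  rw [Finset.card_filter, Finset.sum_product]
  simp only [map_sub]
  rw [Finset.sum_congr rfl fun x _ => sum_fiber A g (fun k => if g x - k = 0 then 1 else 0),
    sum_fiber A g (fun j => cnt A g 0 * (if j - 0 = 0 then 1 else 0) +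
      cnt A g 1 * (if j - 1 = 0 then 1 else 0) + cnt A g 2 * (if j - 2 = 0 then 1 else 0))]
  simp +decide only [if_true, if_false, mul_one, mul_zero, add_zero, zero_add]

lemma card_triples_vanish (A B C : Finset V) (g : Dual (ZMod 3) V) :
    ((A ×ˢ B ×ˢ C).filter (fun p => g (p.1 + p.2.1 + p.2.2) = 0)).card =
      cnt C g 0 * (cnt A g 0 * cnt B g 0 + cnt A g 1 * cnt B g 2 + cnt A g 2 * cnt B g 1) +
      cnt C g 1 * (cnt A g 0 * cnt B g 2 + cnt A g 2 * cnt B g 0 + cnt A g 1 * cnt B g 1) +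
      cnt C g 2 * (cnt A g 0 * cnt B g 1 + cnt A g 1 * cnt B g 0 + cnt A g 2 * cnt B g 2) := by
  rw [Finset.card_filter, Finset.sum_product]
  simp only [Finset.sum_product, map_add]
  let F : ZMod 3 → ZMod 3 → ℕ := fun i j =>
    cnt C g 0 * (if i + j + 0 = 0 then 1 else 0) +
      cnt C g 1 * (if i + j + 1 = 0 then 1 else 0) + cnt C g 2 * (if i + j + 2 = 0 then 1 else 0)
  rw [Finset.sum_congr rfl fun x _ => Finset.sum_congr rfl fun y _ =>
    sum_fiber C g (fun k => if g x + g y + k = 0 then 1 else 0)]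
  rw [Finset.sum_congr rfl fun x _ => sum_fiber B g (F (g x)),
    sum_fiber A g (fun i => cnt B g 0 * F i 0 + cnt B g 1 * F i 1 + cnt B g 2 * F i 2)]
  simp +decide only [F, if_true, if_false, mul_one, mul_zero, add_zero, zero_add]
  ring

end LinearAlgebra

section Hyperplanes

set_option linter.unusedSectionVars false

variable {V : Type} [AddCommGroup V] [Module (ZMod 3) V] [Finite V]

/-- The intersection sizes of `S` with the hyperplanes parallel to `f = 0` pass `ok M t`. -/
def TypeOK (S : Finset V) (M : ℕ) (t : ℕ → ℕ → ℕ → Bool) (f : Dual (ZMod 3) V) : Prop :=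
  ok M t (cnt S f 0) (cnt S f 1) (cnt S f 2) = true

/-- All hyperplane directions pass `ok M t`. -/
def TypesOK (S : Finset V) (M : ℕ) (t : ℕ → ℕ → ℕ → Bool) : Prop :=
  ∀ f : Dual (ZMod 3) V, f ≠ 0 → TypeOK S M t f

/-- All hyperplane directions of all caps in dimension `n` pass `ok M t`. -/
def Level (n M : ℕ) (t : ℕ → ℕ → ℕ → Bool) : Prop :=
  ∀ (V : Type) [AddCommGroup V] [Module (ZMod 3) V] [Finite V],
    finrank (ZMod 3) V = n → ∀ S : Finset V, LineFree S → TypesOK S M t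

/-- Caps in dimension `n` have at most `M` points. -/
def CapBound (n M : ℕ) : Prop :=
  ∀ (V : Type) [AddCommGroup V] [Module (ZMod 3) V] [Finite V],
    finrank (ZMod 3) V = n → ∀ S : Finset V, LineFree S → S.card ≤ M

lemma ok_shift {M : ℕ} {t : ℕ → ℕ → ℕ → Bool} {F : ZMod 3 → ℕ}
    (h : ok M t (F 0) (F 1) (F 2) = true) (i : ZMod 3) {e : ZMod 3} (he : e ≠ 0) :
    ok M t (F i) (F (i + e)) (F (i + 2 * e)) = true := by
  have key : ∀ i e : ZMod 3, e ≠ 0 →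
      (i = 0 ∧ i + e = 1 ∧ i + 2 * e = 2) ∨ (i = 0 ∧ i + e = 2 ∧ i + 2 * e = 1) ∨
      (i = 1 ∧ i + e = 2 ∧ i + 2 * e = 0) ∨ (i = 1 ∧ i + e = 0 ∧ i + 2 * e = 2) ∨
      (i = 2 ∧ i + e = 0 ∧ i + 2 * e = 1) ∨ (i = 2 ∧ i + e = 1 ∧ i + 2 * e = 0) := by decide
  rcases key i e he with ⟨h1, h2, h3⟩ | ⟨h1, h2, h3⟩ | ⟨h1, h2, h3⟩ | ⟨h1, h2, h3⟩ |
    ⟨h1, h2, h3⟩ | ⟨h1, h2, h3⟩ <;> rw [h3, h2, h1]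
  · exact h
  · exact ok_swap h
  · exact ok_rot h
  · exact ok_swap (ok_rot h)
  · exact ok_rot (ok_rot h)
  · exact ok_swap (ok_rot (ok_rot h))

lemma add_shift (F : ZMod 3 → ℕ) (i : ZMod 3) {e : ZMod 3} (he : e ≠ 0) :
    F i + F (i + e) + F (i + 2 * e) = F 0 + F 1 + F 2 := by
  have h : ∀ x y z, ok (F 0 + F 1 + F 2) (fun s _ _ => Nat.beq s (x + y + z)) x y z = true ↔
      x ≤ F 0 + F 1 + F 2 ∧ y ≤ F 0 + F 1 + F 2 ∧ z ≤ F 0 + F 1 + F 2 := by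
    intro x y z
    simp [ok_iff]
  have h0 : ok (F 0 + F 1 + F 2) (fun s _ _ => Nat.beq s (F 0 + F 1 + F 2))
      (F 0) (F 1) (F 2) = true := by
    simp only [ok_iff, Nat.beq_eq, and_true]
    omega
  have := ok_shift h0 i he
  simpa only [ok_iff, Nat.beq_eq] using (ok_iff.1 this).2.2.2

lemma exists_slice {h : Dual (ZMod 3) V} (hh : h ≠ 0) (S : Finset V) (hS : LineFree S)
    (l : ZMod 3) : ∃ (v : V) (S' : Finset (LinearMap.ker h)), LineFree S' ∧
      S'.card = cnt S h l ∧ ∀ (f : Dual (ZMod 3) V) (j : ZMod 3),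
        cnt S' (f.domRestrict (LinearMap.ker h)) j =
          cnt (S.filter (fun x => h x = l)) f (j + f v) := by
  classical
  obtain ⟨v, hv⟩ := LinearMap.surjective hh l
  have hinj : Function.Injective (fun w : LinearMap.ker h => (w : V) + v) := by
    intro a b hab
    exact Subtype.ext (add_right_cancel hab)
  have hmem : ∀ w : LinearMap.ker h, h ((w : V) + v) = l := by
    intro w
    rw [map_add, LinearMap.mem_ker.1 w.2, zero_add, hv]
  let S' : Finset (LinearMap.ker h) := S.preimage (fun w => (w : V) + v) hinj.injOn
  have hcard : ∀ P : V → Prop, (S'.filter (fun w : LinearMap.ker h => P ((w : V) + v))).card =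
      (S.filter (fun x => h x = l ∧ P x)).card := by
    intro P
    refine Finset.card_bij (fun w _ => (w : V) + v) ?_ (fun a _ b _ hab => hinj hab) ?_
    · intro w hw
      simp only [S', Finset.mem_filter, Finset.mem_preimage] at hw ⊢
      exact ⟨hw.1, hmem w, hw.2⟩
    · intro x hx
      simp only [Finset.mem_filter] at hx
      refine ⟨⟨x - v, ?_⟩, ?_, sub_add_cancel x v⟩
      · rw [LinearMap.mem_ker, map_sub, hx.2.1, hv, sub_self]
      · simpa [S'] using ⟨hx.1, hx.2.2⟩
  refine ⟨v, S', ?_, ?_, ?_⟩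
  · intro x hx y hy z hz hxyz
    simp only [S', Finset.mem_preimage] at hx hy hz
    have hv3 : v + v + v = 0 := by
      have h3 : (3 : ZMod 3) • v = 0 := by
        rw [show (3 : ZMod 3) = 0 from rfl, zero_smul]
      rw [← h3]
      module
    have hsum : (x : V) + y + z = 0 := by exact_mod_cast congrArg Subtype.val hxyz
    have := hS _ hx _ hy _ hz (by
      calc (x : V) + v + (y + v) + (z + v) = (x + y + z) + (v + v + v) := by abel
        _ = 0 := by rw [hsum, hv3, add_zero])
    exact ⟨hinj this.1, hinj this.2⟩
  · simpa [cnt] using hcard (fun _ => True)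
  · intro f j
    have := hcard (fun x => f x = j + f v)
    simp only [map_add, add_left_inj] at this
    rw [cnt, cnt, Finset.filter_filter]
    convert this
    rfl

lemma finrank_ker_dual {n : ℕ} (hn : finrank (ZMod 3) V = n + 1) {h : Dual (ZMod 3) V}
    (hh : h ≠ 0) : finrank (ZMod 3) (LinearMap.ker h) = n := by
  have := Module.Dual.finrank_ker_add_one_of_ne_zero (f := h) hh
  omega

lemma mem_indep_iff_ne_smul {f g : Dual (ZMod 3) V} :
    g ∈ indep f ↔ ∀ c : ZMod 3, g ≠ c • f := by
  have hm : (-1 : ZMod 3) • f = -f := by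
    ext x
    simp
  rw [mem_indep]
  constructor
  · rintro ⟨h0, h1, h2⟩ c
    have hc : ∀ c : ZMod 3, c = 0 ∨ c = 1 ∨ c = -1 := by decide
    rcases hc c with rfl | rfl | rfl
    · simpa using h0
    · simpa using h1
    · rwa [hm]
  · intro h
    exact ⟨by simpa using h 0, by simpa using h 1, by rw [← hm]; exact h (-1)⟩

lemma Level.slice {n M : ℕ} {t : ℕ → ℕ → ℕ → Bool} (hL : Level n M t)
    (hn : finrank (ZMod 3) V = n + 1) {S : Finset V} (hS : LineFree S)
    {f h : Dual (ZMod 3) V} (hh : h ≠ 0) (hf : f ∈ indep h) (l : ZMod 3) :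
    TypeOK (S.filter (fun x => h x = l)) M t f := by
  obtain ⟨v, S', hS', -, hcnt⟩ := exists_slice hh S hS l
  have hres : f.domRestrict (LinearMap.ker h) ≠ 0 := by
    intro h0
    obtain ⟨u, hu⟩ := LinearMap.surjective hh 1
    refine mem_indep_iff_ne_smul.1 hf (f u) ?_
    ext x
    have := LinearMap.congr_fun h0 ⟨x - h x • u, by simp [hu]⟩
    simp only [LinearMap.domRestrict_apply, map_sub, map_smul, LinearMap.zero_apply,
      smul_eq_mul, sub_eq_zero] at this
    rw [this, LinearMap.smul_apply, smul_eq_mul, mul_comm]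
  have h1 := hL _ (finrank_ker_dual hn hh) S' hS' _ hres
  rw [TypeOK, hcnt, hcnt, hcnt] at h1
  have h2 := ok_shift (F := fun j => cnt (S.filter (fun x => h x = l)) f (j + f v)) h1
    (-f v) one_ne_zero
  simpa [TypeOK, add_assoc, add_comm] using h2

/-- The number of points of `S` with `f = i` and `g = l`. -/
noncomputable def cell (S : Finset V) (f g : Dual (ZMod 3) V) (i l : ZMod 3) : ℕ :=
  cnt (S.filter (fun x => f x = i)) g l

lemma cell_shear (S : Finset V) (f g : Dual (ZMod 3) V) (i e ρ l d : ZMod 3) (he : e ≠ 0) :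
    cell S f g (i + ρ * e) (l + ρ * d) =
      cnt (S.filter (fun x => (g - (d * e) • f) x = l - d * e * i)) f (i + ρ * e) := by
  rw [cell, cnt, cnt, Finset.filter_filter, Finset.filter_filter]
  congr 1
  ext x
  simp only [Finset.mem_filter, LinearMap.sub_apply, LinearMap.smul_apply, smul_eq_mul,
    and_congr_right_iff]
  intro _
  have key : ∀ e i ρ l d a b : ZMod 3, e ≠ 0 → ((a = i + ρ * e ∧ b = l + ρ * d) ↔
      (b - d * e * a = l - d * e * i ∧ a = i + ρ * e)) := by
    intro e i ρ l d a b he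
    have he2 : e * e = 1 := by revert e; decide
    constructor
    · rintro ⟨rfl, rfl⟩
      exact ⟨by linear_combination (-(d * ρ)) * he2, rfl⟩
    · rintro ⟨h, rfl⟩
      exact ⟨rfl, by linear_combination h + d * ρ * he2⟩
  exact key e i ρ l d _ _ he

lemma sub_smul_mem_indep {f g : Dual (ZMod 3) V} (hg : g ∈ indep f) (c : ZMod 3) :
    g - c • f ∈ indep f := by
  rw [mem_indep_iff_ne_smul] at *
  intro a h
  exact hg (a + c) (by rw [add_smul, ← h, sub_add_cancel])

lemma indep_symm {f g : Dual (ZMod 3) V} (hf : f ≠ 0) (hg : g ∈ indep f) : f ∈ indep g := by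
  rw [mem_indep] at *
  exact ⟨hf, hg.2.1.symm, fun h => hg.2.2 (by rw [h, neg_neg])⟩

/-- The grid of cell counts of `f` and `g`, with rows in the order `i`, `i + e`, `i + 2 * e`. -/
noncomputable def gridOf (S : Finset V) (f g : Dual (ZMod 3) V) (i e : ZMod 3) : Grid :=
  ⟨cell S f g i 0, cell S f g i 1, cell S f g i 2, cell S f g (i + e) 0, cell S f g (i + e) 1,
    cell S f g (i + e) 2, cell S f g (i + 2 * e) 0, cell S f g (i + 2 * e) 1,
    cell S f g (i + 2 * e) 2⟩

lemma lines_gridOf {n M : ℕ} {t : ℕ → ℕ → ℕ → Bool} (hL : Level n M t)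
    (hn : finrank (ZMod 3) V = n + 1) {S : Finset V} (hS : LineFree S)
    {f g : Dual (ZMod 3) V} (hf : f ≠ 0) (hg : g ∈ indep f) (i : ZMod 3) {e : ZMod 3}
    (he : e ≠ 0) : (gridOf S f g i e).lines M t = true := by
  have row : ∀ i, ok M t (cell S f g i 0) (cell S f g i 1) (cell S f g i 2) = true :=
    fun i => hL.slice hn hS hf hg i
  have line : ∀ l d, ok M t (cell S f g i l) (cell S f g (i + e) (l + d))
      (cell S f g (i + 2 * e) (l + 2 * d)) = true := by
    intro l d
    have hd := sub_smul_mem_indep hg (d * e)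
    have := ok_shift (hL.slice hn hS (mem_indep.1 hd).1 (indep_symm hf hd) (l - d * e * i)) i he
    have h0 := cell_shear S f g i e 0 l d he
    have h1 := cell_shear S f g i e 1 l d he
    have h2 := cell_shear S f g i e 2 l d he
    simp only [zero_mul, add_zero, one_mul] at h0 h1 h2
    rwa [h0, h1, h2]
  simp only [Grid.lines, Bool.and_eq_true]
  exact ⟨row _, row _, row _, line 0 0, line 1 0, line 2 0, line 0 1, line 1 1, line 2 1,
    line 0 2, line 1 2, line 2 2⟩

lemma add_cell (S : Finset V) (f g : Dual (ZMod 3) V) (i : ZMod 3) {e : ZMod 3} (he : e ≠ 0)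
    (l d : ZMod 3) : cell S f g i l + cell S f g (i + e) (l + d) +
      cell S f g (i + 2 * e) (l + 2 * d) = cnt S (g - (d * e) • f) (l - d * e * i) := by
  have h0 := cell_shear S f g i e 0 l d he
  have h1 := cell_shear S f g i e 1 l d he
  have h2 := cell_shear S f g i e 2 l d he
  simp only [zero_mul, add_zero, one_mul] at h0 h1 h2
  rw [h0, h1, h2, add_shift _ i he, cnt_add]
  rfl

lemma dirs_gridOf {M : ℕ} {t : ℕ → ℕ → ℕ → Bool} {S : Finset V} (hT : TypesOK S M t)
    {f g : Dual (ZMod 3) V} (hg : g ∈ indep f) (i : ZMod 3) {e : ZMod 3}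
    (he : e ≠ 0) : (gridOf S f g i e).dirs M t = true := by
  have dir : ∀ d, ok M t
      (cell S f g i 0 + cell S f g (i + e) (0 + d) + cell S f g (i + 2 * e) (0 + 2 * d))
      (cell S f g i 1 + cell S f g (i + e) (1 + d) + cell S f g (i + 2 * e) (1 + 2 * d))
      (cell S f g i 2 + cell S f g (i + e) (2 + d) + cell S f g (i + 2 * e) (2 + 2 * d)) =
        true := by
    intro d
    rw [add_cell S f g i he, add_cell S f g i he, add_cell S f g i he]
    have := ok_shift (hT _ (mem_indep.1 (sub_smul_mem_indep hg (d * e))).1) (-(d * e * i))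
      one_ne_zero
    convert this using 3 <;> ring
  simp only [Grid.dirs, Bool.and_eq_true]
  exact ⟨dir 0, dir 1, dir 2⟩

lemma typeOK_of_dirs_gridOf {M : ℕ} {t : ℕ → ℕ → ℕ → Bool} {S : Finset V}
    {f g : Dual (ZMod 3) V} {i e : ZMod 3} (he : e ≠ 0)
    (h : (gridOf S f g i e).dirs M t = true) : TypeOK S M t g := by
  simp only [Grid.dirs, Bool.and_eq_true] at h
  have h1 : ∀ l, cell S f g i l + cell S f g (i + e) l + cell S f g (i + 2 * e) l =
      cnt S g l := fun l => by simpa using add_cell S f g i he l 0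
  have := h.1
  simp only [gridOf, Nat.add_eq, h1] at this
  exact this

end Hyperplanes

section Counting

set_option linter.unusedSectionVars false

variable {V : Type} [AddCommGroup V] [Module (ZMod 3) V] [Finite V] {n : ℕ} {S A B C : Finset V}
  {f : Dual (ZMod 3) V}

lemma LineFree.mono (hS : LineFree S) (h : A ⊆ S) : LineFree A :=
  fun x hx y hy z hz => hS x (h hx) y (h hy) z (h hz)

lemma add_self_add_self (x : V) : x + x + x = 0 := by
  have h3 : (3 : ZMod 3) • x = 0 := by
    rw [show (3 : ZMod 3) = 0 from rfl, zero_smul]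
  rw [← h3]
  module

lemma card_filter_sub_eq_zero [DecidableEq V] (A : Finset V) :
    ((A ×ˢ A).filter (fun p => p.1 - p.2 = 0)).card = A.card := by
  rw [Finset.card_filter, Finset.sum_product]
  simp [sub_eq_zero]

lemma LineFree.card_filter_add_eq_zero [DecidableEq V] (hA : LineFree A) :
    ((A ×ˢ A ×ˢ A).filter (fun p => p.1 + p.2.1 + p.2.2 = 0)).card = A.card := by
  symm
  refine Finset.card_bij (fun x _ => (x, x, x)) ?_ ?_ ?_
  · intro x hx
    simp [hx, add_self_add_self]
  · intro x _ y _ h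
    exact congrArg Prod.fst h
  · rintro ⟨x, y, z⟩ h
    simp only [Finset.mem_filter, Finset.mem_product] at h
    obtain ⟨rfl, rfl⟩ := hA x h.1.1 y h.1.2.1 z h.1.2.2 h.2
    exact ⟨x, h.1.1, rfl⟩

lemma sum_indep_sumSq (hn : finrank (ZMod 3) V = n + 1) (hf : f ≠ 0) {i : ZMod 3}
    (hA : ∀ x ∈ A, f x = i) :
    ∑ g ∈ indep f, sumSq (cnt A g 0) (cnt A g 1) (cnt A g 2) + 3 * (A.card * A.card) =
      3 ^ n * (A.card * A.card + 2 * A.card) := by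
  classical
  have h := sum_indep_card_vanish hn hf (A ×ˢ A) (fun p => p.1 - p.2) (by
    intro p hp
    rw [Finset.mem_product] at hp
    rw [map_sub, hA _ hp.1, hA _ hp.2, sub_self])
  simp only [card_pairs_vanish, Finset.card_product] at h
  refine h.trans ?_
  congr 3
  convert card_filter_sub_eq_zero A

lemma sum_indep_tri (hn : finrank (ZMod 3) V = n + 1) (hf : f ≠ 0) {i : ZMod 3}
    (hA : ∀ x ∈ A, f x = i) (hS : LineFree A) :
    ∑ g ∈ indep f, tri (cnt A g 0) (cnt A g 1) (cnt A g 2) + 3 * (A.card * (A.card * A.card)) =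
      3 ^ n * (A.card * (A.card * A.card) + 2 * A.card) := by
  classical
  have h := sum_indep_card_vanish hn hf (A ×ˢ A ×ˢ A) (fun p => p.1 + p.2.1 + p.2.2) (by
    intro p hp
    simp only [Finset.mem_product] at hp
    rw [map_add, map_add, hA _ hp.1, hA _ hp.2.1, hA _ hp.2.2]
    exact add_self_add_self i)
  simp only [card_triples_vanish, Finset.card_product, hS.card_filter_add_eq_zero] at h
  rw [← h]
  congr 1
  refine Finset.sum_congr rfl fun g _ => ?_
  rw [tri_eq]
  ring

lemma sum_indep_mix (hn : finrank (ZMod 3) V = n + 1) (hf : f ≠ 0) {i e : ZMod 3} (he : e ≠ 0)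
    (hS : LineFree S) (hA : A = S.filter (fun x => f x = i))
    (hB : B = S.filter (fun x => f x = i + e)) (hC : C = S.filter (fun x => f x = i + 2 * e)) :
    ∑ g ∈ indep f, mix (cnt A g 0) (cnt A g 1) (cnt A g 2) (cnt B g 0) (cnt B g 1) (cnt B g 2)
      (cnt C g 0) (cnt C g 1) (cnt C g 2) + 3 * (A.card * (B.card * C.card)) =
      3 ^ n * (A.card * (B.card * C.card)) := by
  classical
  have h := sum_indep_card_vanish hn hf (A ×ˢ B ×ˢ C) (fun p => p.1 + p.2.1 + p.2.2) (by
    intro p hp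
    simp only [hA, hB, hC, Finset.mem_product, Finset.mem_filter] at hp
    rw [map_add, map_add, hp.1.2, hp.2.1.2, hp.2.2.2]
    linear_combination add_self_add_self i + add_self_add_self e)
  have h0 : (A ×ˢ B ×ˢ C).filter (fun p => p.1 + p.2.1 + p.2.2 = 0) = ∅ := by
    refine Finset.filter_eq_empty_iff.2 fun p hp h0 => ?_
    simp only [hA, hB, hC, Finset.mem_product, Finset.mem_filter] at hp
    have h1 := (hS _ hp.1.1 _ hp.2.1.1 _ hp.2.2.1 h0).1
    have h2 := hp.2.1.2
    rw [← h1, hp.1.2] at h2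
    exact he (by linear_combination -h2)
  simp only [card_triples_vanish, Finset.card_product, h0, Finset.card_empty, mul_zero,
    add_zero] at h
  exact h

/-- The sum of the statistic of a grid over all functionals independent of the rows. -/
def Cert.total (c : Cert) (q a b d : ℤ) : ℤ :=
  c.A * (q * (a * a + 2 * a) - 3 * (a * a)) + c.B * (q * (b * b + 2 * b) - 3 * (b * b)) +
  c.C * (q * (d * d + 2 * d) - 3 * (d * d)) + c.D * (q * (a * (a * a) + 2 * a) - 3 * (a * (a * a))) +
  c.E * (q * (b * (b * b) + 2 * b) - 3 * (b * (b * b))) +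
  c.F * (q * (d * (d * d) + 2 * d) - 3 * (d * (d * d))) + c.k * ((q - 3) * (a * (b * d)))

lemma sum_lin (hn : finrank (ZMod 3) V = n + 1) (hf : f ≠ 0) {i e : ZMod 3} (he : e ≠ 0)
    (hS : LineFree S) (c : Cert) :
    ∑ g ∈ indep f, c.lin (gridOf S f g i e) =
      c.total (3 ^ n) (cnt S f i) (cnt S f (i + e)) (cnt S f (i + 2 * e)) := by
  have hrow : ∀ i, ∀ x ∈ S.filter (fun x => f x = i), f x = i :=
    fun i x hx => (Finset.mem_filter.1 hx).2
  have P := fun i => congrArg (Nat.cast (R := ℤ)) (sum_indep_sumSq hn hf (hrow i))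
  have T := fun i => congrArg (Nat.cast (R := ℤ))
    (sum_indep_tri hn hf (hrow i) (hS.mono (Finset.filter_subset _ _)))
  have X := congrArg (Nat.cast (R := ℤ)) (sum_indep_mix hn hf (i := i) he hS rfl rfl rfl)
  push_cast at P T X
  simp only [Cert.lin, gridOf, cell, Finset.sum_add_distrib, ← Finset.mul_sum, Cert.total]
  change ∀ i, _ + 3 * ((cnt S f i : ℤ) * cnt S f i) =
    3 ^ n * ((cnt S f i : ℤ) * cnt S f i + 2 * cnt S f i) at P
  change ∀ i, _ + 3 * ((cnt S f i : ℤ) * (cnt S f i * cnt S f i)) =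
    3 ^ n * ((cnt S f i : ℤ) * (cnt S f i * cnt S f i) + 2 * cnt S f i) at T
  change _ + 3 * ((cnt S f i : ℤ) * (cnt S f (i + e) * cnt S f (i + 2 * e))) =
    3 ^ n * ((cnt S f i : ℤ) * (cnt S f (i + e) * cnt S f (i + 2 * e))) at X
  linear_combination c.A * P i + c.B * P (i + e) + c.C * P (i + 2 * e) + c.D * T i +
    c.E * T (i + e) + c.F * T (i + 2 * e) + c.k * X

theorem row_bound (hn : finrank (ZMod 3) V = n + 1) (hS : LineFree S) {M₁ M₂ : ℕ}
    {s t t' : ℕ → ℕ → ℕ → Bool} (hL : Level n M₁ s) (hT : TypesOK S M₂ t) {c : Cert}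
    (hf : f ≠ 0) {i e : ZMod 3} (he : e ≠ 0)
    (hc : c.gridCheck M₁ M₂ s t t' (cnt S f i) (cnt S f (i + e)) (cnt S f (i + 2 * e)) = true) :
    c.K * (3 * 3 ^ n - 3) ≤
      c.total (3 ^ n) (cnt S f i) (cnt S f (i + e)) (cnt S f (i + 2 * e)) ∧
    (c.total (3 ^ n) (cnt S f i) (cnt S f (i + e)) (cnt S f (i + 2 * e)) ≤
      c.K * (3 * 3 ^ n - 3) → ∀ g ∈ indep f, TypeOK S M₂ t' g) := by
  have hgood : ∀ g ∈ indep f, c.K ≤ c.lin (gridOf S f g i e) ∧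
      (c.lin (gridOf S f g i e) = c.K → (gridOf S f g i e).dirs M₂ t' = true) := by
    intro g hg
    exact c.good_of_gridCheck hc _ (lines_gridOf hL hn hS hf hg i he)
      (dirs_gridOf hT hg i he) (cnt_add _ g) (cnt_add _ g) (cnt_add _ g)
  have hcard : ∑ g ∈ indep f, c.K = c.K * (3 * 3 ^ n - 3) := by
    have : ((indep f).card : ℤ) + 3 = 3 * 3 ^ n := by exact_mod_cast card_indep hn hf
    rw [Finset.sum_const, nsmul_eq_mul]
    linear_combination c.K * this
  rw [← hcard, ← sum_lin hn hf he hS c]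
  have hle : ∀ g ∈ indep f, c.K ≤ c.lin (gridOf S f g i e) := fun g hg => (hgood g hg).1
  refine ⟨Finset.sum_le_sum hle, fun h g hg => ?_⟩
  have := (Finset.sum_eq_sum_iff_of_le hle).1 (le_antisymm (Finset.sum_le_sum hle) h) g hg
  exact typeOK_of_dirs_gridOf he ((hgood g hg).2 this.symm)

lemma exists_shift (F : ZMod 3 → ℕ) {p q r : ℕ} (h1 : F 0 + F 1 + F 2 = p + q + r)
    (h2 : sumSq (F 0) (F 1) (F 2) = sumSq p q r) (h3 : F 0 * F 1 * F 2 = p * q * r) :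
    ∃ i e : ZMod 3, e ≠ 0 ∧ F i = p ∧ F (i + e) = q ∧ F (i + 2 * e) = r := by
  have two : ∀ {x y z w : ℤ}, x + y = z + w → x * x + y * y = z * z + w * w →
      (x = z ∧ y = w) ∨ (x = w ∧ y = z) := by
    intro x y z w h h'
    have : 2 * ((x - z) * (x - w)) = 0 := by
      obtain rfl : y = z + w - x := by linear_combination h
      linear_combination h'
    rcases mul_eq_zero.1 ((mul_eq_zero.1 this).resolve_left two_ne_zero) with h0 | h0
    · exact .inl ⟨by linear_combination h0, by linear_combination h - h0⟩
    · exact .inr ⟨by linear_combination h0, by linear_combination h - h0⟩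
  simp only [sumSq_eq] at h2
  zify at h1 h2 h3
  have key : 2 * (((p : ℤ) - F 0) * (p - F 1) * (p - F 2)) = 0 := by
    linear_combination (-2 * (p : ℤ) ^ 2 + p * (F 0 + F 1 + F 2 + p + q + r)) * h1 - p * h2 - 2 * h3
  rcases mul_eq_zero.1 ((mul_eq_zero.1 key).resolve_left two_ne_zero) with h | h
  · rcases mul_eq_zero.1 h with h | h
    · rcases two (x := F 1) (y := F 2) (z := q) (w := r) (by linear_combination h1 + h)
        (by linear_combination h2 + (F 0 + p) * h) with ⟨h4, h5⟩ | ⟨h4, h5⟩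
      · exact ⟨0, 1, by decide, by omega, by exact_mod_cast h4, by exact_mod_cast h5⟩
      · exact ⟨0, 2, by decide, by omega, by exact_mod_cast h5, by exact_mod_cast h4⟩
    · rcases two (x := F 0) (y := F 2) (z := q) (w := r) (by linear_combination h1 + h)
        (by linear_combination h2 + (F 1 + p) * h) with ⟨h4, h5⟩ | ⟨h4, h5⟩
      · exact ⟨1, 2, by decide, by omega, by exact_mod_cast h4, by exact_mod_cast h5⟩
      · exact ⟨1, 1, by decide, by omega, by exact_mod_cast h5, by exact_mod_cast h4⟩
  · rcases two (x := F 0) (y := F 1) (z := q) (w := r) (by linear_combination h1 + h)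
      (by linear_combination h2 + (F 2 + p) * h) with ⟨h4, h5⟩ | ⟨h4, h5⟩
    · exact ⟨2, 1, by decide, by omega, by exact_mod_cast h4, by exact_mod_cast h5⟩
    · exact ⟨2, 2, by decide, by omega, by exact_mod_cast h5, by exact_mod_cast h4⟩

/-- A certificate together with the row type it excludes. -/
structure RowCert where
  (p q r : ℕ)
  cert : Cert

/-- The test on sum, sum of squares and product which detects a triple up to order. -/
def isType (p q r s P Q : ℕ) : Bool :=
  Nat.beq s (p + q + r) && (Nat.beq P (sumSq p q r) && Nat.beq Q (p * q * r))

/-- The test `t` with the row types in a list excluded. -/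
def without (t : ℕ → ℕ → ℕ → Bool) (L : List RowCert) (s P Q : ℕ) : Bool :=
  t s P Q && L.all fun e => !isType e.p e.q e.r s P Q

/-- The always successful test. -/
def anyType (_ _ _ : ℕ) : Bool := true

/-- The test which always fails. -/
def noType (_ _ _ : ℕ) : Bool := false

/-- The row type of a certificate cannot occur, given that grids have lines which pass `ok M₁ s`
and directions which pass `ok M₂ t`. -/
noncomputable def RowCert.check (n M₁ M₂ : ℕ) (s t : ℕ → ℕ → ℕ → Bool) (e : RowCert) : Bool :=
  decide (e.cert.total (3 ^ n) e.p e.q e.r < e.cert.K * (3 * 3 ^ n - 3)) &&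
    e.cert.gridCheck M₁ M₂ s t anyType e.p e.q e.r

theorem TypesOK.without (hn : finrank (ZMod 3) V = n + 1) (hS : LineFree S) {M₁ M₂ : ℕ}
    {s t : ℕ → ℕ → ℕ → Bool} (hL : Level n M₁ s) (hT : TypesOK S M₂ t) {L : List RowCert}
    (hc : L.all (RowCert.check n M₁ M₂ s t) = true) : TypesOK S M₂ (without t L) := by
  intro f hf
  have h := ok_iff.1 (hT f hf)
  refine ok_iff.2 ⟨h.1, h.2.1, h.2.2.1, ?_⟩
  rw [_root_.without, h.2.2.2, Bool.true_and, List.all_eq_true]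
  intro e he
  have hce := List.all_eq_true.1 hc e he
  rw [Bool.not_eq_true', Bool.eq_false_iff]
  intro ht
  simp only [isType, Bool.and_eq_true, Nat.beq_eq] at ht
  obtain ⟨i, d, hd, hp, hq, hr⟩ := exists_shift (cnt S f) ht.1 ht.2.1 ht.2.2
  simp only [RowCert.check, Bool.and_eq_true, decide_eq_true_eq, ← hp, ← hq, ← hr] at hce
  exact absurd (row_bound hn hS hL hT hf hd hce.2).1 (not_le.2 hce.1)

lemma TypeOK.neg {M : ℕ} {t : ℕ → ℕ → ℕ → Bool} (h : TypeOK S M t f) : TypeOK S M t (-f) := by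
  have hneg : ∀ i, cnt S (-f) i = cnt S f (-i) := by
    intro i
    simp only [cnt, LinearMap.neg_apply, neg_eq_iff_eq_neg]
  rw [TypeOK, hneg, hneg, hneg]
  simpa using ok_shift h 0 (e := -1) (by decide)

/-- If some direction has the row type of a tight certificate, then all other directions have
the types allowed by the equality case. -/
theorem TypesOK.of_row (hn : finrank (ZMod 3) V = n + 1) (hS : LineFree S) {M₁ M₂ : ℕ}
    {s t t' : ℕ → ℕ → ℕ → Bool} (hL : Level n M₁ s) (hT : TypesOK S M₂ t) {e : RowCert}
    (ht' : ok M₂ t' e.p e.q e.r = true)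
    (hc : e.cert.gridCheck M₁ M₂ s t t' e.p e.q e.r = true)
    (htot : e.cert.total (3 ^ n) e.p e.q e.r ≤ e.cert.K * (3 * 3 ^ n - 3))
    (hrow : ¬ TypesOK S M₂ (_root_.without t [e])) : TypesOK S M₂ t' := by
  simp only [TypesOK, not_forall] at hrow
  obtain ⟨f, hf, hrow⟩ := hrow
  have h := ok_iff.1 (hT f hf)
  have ht : isType e.p e.q e.r (cnt S f 0 + cnt S f 1 + cnt S f 2)
      (sumSq (cnt S f 0) (cnt S f 1) (cnt S f 2)) (cnt S f 0 * cnt S f 1 * cnt S f 2) = true := by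
    by_contra hne
    refine hrow (ok_iff.2 ⟨h.1, h.2.1, h.2.2.1, ?_⟩)
    rw [Bool.not_eq_true] at hne
    simp [_root_.without, h.2.2.2, hne]
  simp only [isType, Bool.and_eq_true, Nat.beq_eq] at ht
  have hf' : TypeOK S M₂ t' f := by
    have h' := ok_iff.1 ht'
    refine ok_iff.2 ⟨h.1, h.2.1, h.2.2.1, ?_⟩
    rw [ht.1, ht.2.1, ht.2.2]
    exact h'.2.2.2
  obtain ⟨i, d, hd, hp, hq, hr⟩ := exists_shift (cnt S f) ht.1 ht.2.1 ht.2.2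
  rw [← hp, ← hq, ← hr] at hc htot
  have hb := (row_bound hn hS hL hT hf hd hc).2 htot
  intro g hg
  by_cases h1 : g = f
  · rwa [h1]
  by_cases h2 : g = -f
  · rw [h2]
    exact hf'.neg
  exact hb g (mem_indep.2 ⟨hg, h1, h2⟩)

end Counting

section Steps

variable {V : Type} [AddCommGroup V] [Module (ZMod 3) V] [Finite V] {n m M : ℕ} {S : Finset V}
  {t t' : ℕ → ℕ → ℕ → Bool}

lemma ok_rot_eq (x y z : ℕ) : ok M t x y z = ok M t y z x :=
  Bool.eq_iff_iff.2 ⟨ok_rot, fun h => ok_rot (ok_rot h)⟩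

lemma ok_swap_eq (x y z : ℕ) : ok M t x y z = ok M t x z y :=
  Bool.eq_iff_iff.2 ⟨ok_swap, ok_swap⟩

lemma rowStat_rot (α β x y z : ℕ) : rowStat α β x y z = rowStat α β y z x := by
  simp only [rowStat_eq, sumSq_eq, tri_eq]
  ring

lemma rowStat_swap (α β x y z : ℕ) : rowStat α β x y z = rowStat α β x z y := by
  simp only [rowStat_eq, sumSq_eq, tri_eq]
  ring

lemma forall_of_sortedRows {s : ℕ} {p : ℕ → ℕ → ℕ → Bool} (h : sortedRows s p = true)
    (hrot : ∀ x y z, p x y z = p y z x) (hswap : ∀ x y z, p x y z = p x z y) {x y z : ℕ}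
    (hs : x + y + z = s) : p x y z = true := by
  rcases le_total x y with hxy | hxy <;> rcases le_total y z with hyz | hyz <;>
    rcases le_total x z with hxz | hxz
  · exact sortedRows_spec h hs hxy hyz
  · exact sortedRows_spec h hs hxy hyz
  · rw [hswap]
    exact sortedRows_spec h (by omega) hxz hyz
  · rw [hrot, hrot]
    exact sortedRows_spec h (by omega) hxz hxy
  · rw [hrot, hswap]
    exact sortedRows_spec h (by omega) hxy hxz
  · rw [hrot]
    exact sortedRows_spec h (by omega) hyz hxz
  · rw [hrot, hrot, hswap]
    exact sortedRows_spec h (by omega) hyz hxy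
  · rw [hrot, hrot, hswap]
    exact sortedRows_spec h (by omega) hyz hxy

/-- Among triples with sum `m`, the test `ok M t` implies `ok M t'`. -/
noncomputable def narrowCheck (m M : ℕ) (t t' : ℕ → ℕ → ℕ → Bool) : Bool :=
  sortedRows m fun x y z => !ok M t x y z || ok M t' x y z

theorem TypesOK.narrow (hT : TypesOK S M t) (hm : S.card = m)
    (hc : narrowCheck m M t t' = true) : TypesOK S M t' := by
  intro f hf
  have h := forall_of_sortedRows hc
    (fun x y z => by rw [ok_rot_eq x y z, ok_rot_eq (t := t') x y z])
    (fun x y z => by rw [ok_swap_eq x y z, ok_swap_eq (t := t') x y z]) ((cnt_add S f).trans hm)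
  have hf' := hT f hf
  rw [TypeOK] at hf'
  rwa [hf', Bool.not_true, Bool.false_or] at h

lemma sum_sumSq (hn : finrank (ZMod 3) V = n + 1) (S : Finset V) :
    ∑ g : Dual (ZMod 3) V, sumSq (cnt S g 0) (cnt S g 1) (cnt S g 2) =
      3 ^ n * (S.card * S.card + 2 * S.card) := by
  classical
  have h := sum_card_vanish hn (S ×ˢ S) (fun p => p.1 - p.2)
  simp only [card_pairs_vanish, Finset.card_product] at h
  refine h.trans ?_
  congr 3
  convert card_filter_sub_eq_zero S

lemma sum_tri (hn : finrank (ZMod 3) V = n + 1) (hS : LineFree S) :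
    ∑ g : Dual (ZMod 3) V, tri (cnt S g 0) (cnt S g 1) (cnt S g 2) =
      3 ^ n * (S.card * (S.card * S.card) + 2 * S.card) := by
  classical
  have h := sum_card_vanish hn (S ×ˢ S ×ˢ S) (fun p => p.1 + p.2.1 + p.2.2)
  simp only [card_triples_vanish, Finset.card_product, hS.card_filter_add_eq_zero] at h
  rw [← h]
  refine Finset.sum_congr rfl fun g _ => ?_
  rw [tri_eq]
  ring

/-- Triples with sum `m` which pass `ok M t` have statistic at least `K`, and more than `K` unless
they pass `ok M t'`. -/
noncomputable def globalCheck (α β K m M : ℕ) (t t' : ℕ → ℕ → ℕ → Bool) : Bool :=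
  sortedRows m fun x y z => !ok M t x y z || (Nat.blt K (rowStat α β x y z) ||
    (Nat.beq K (rowStat α β x y z) && ok M t' x y z))

theorem TypesOK.global (hT : TypesOK S M t) (hn : finrank (ZMod 3) V = n + 1) (hS : LineFree S)
    (hm : S.card = m) {α β K : ℕ} (hc : globalCheck α β K m M t t' = true)
    (htot : α * (3 ^ n * (m * m + 2 * m)) + β * (3 ^ n * (m * (m * m) + 2 * m)) + K ≤
      K * (3 ^ (n + 1)) + α * (m * m) + β * (m * (m * m))) : TypesOK S M t' := by
  classical
  have key : ∀ f : Dual (ZMod 3) V, f ≠ 0 → K ≤ rowStat α β (cnt S f 0) (cnt S f 1) (cnt S f 2) ∧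
      (K = rowStat α β (cnt S f 0) (cnt S f 1) (cnt S f 2) → TypeOK S M t' f) := by
    intro f hf
    have h := forall_of_sortedRows hc
      (fun x y z => by
        rw [ok_rot_eq x y z, ok_rot_eq (t := t') x y z, rowStat_rot α β x y z])
      (fun x y z => by
        rw [ok_swap_eq x y z, ok_swap_eq (t := t') x y z, rowStat_swap α β x y z])
      ((cnt_add S f).trans hm)
    have hf' := hT f hf
    rw [TypeOK] at hf'
    rw [hf', Bool.not_true, Bool.false_or, Bool.or_eq_true, Bool.and_eq_true, Nat.blt_eq,
      Nat.beq_eq] at h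
    rcases h with h | h
    · exact ⟨h.le, fun e => absurd e h.ne⟩
    · exact ⟨h.1.le, fun _ => h.2⟩
  have hle : ∀ f ∈ Finset.univ.erase (0 : Dual (ZMod 3) V),
      K ≤ rowStat α β (cnt S f 0) (cnt S f 1) (cnt S f 2) :=
    fun f hf => (key f (Finset.ne_of_mem_erase hf)).1
  have hsum : ∑ f : Dual (ZMod 3) V, rowStat α β (cnt S f 0) (cnt S f 1) (cnt S f 2) =
      α * (3 ^ n * (m * m + 2 * m)) + β * (3 ^ n * (m * (m * m) + 2 * m)) := by
    simp only [rowStat_eq, Finset.sum_add_distrib, ← Finset.mul_sum, sum_sumSq hn,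
      sum_tri hn hS, hm]
  have hzero : rowStat α β (cnt S (0 : Dual (ZMod 3) V) 0) (cnt S (0 : Dual (ZMod 3) V) 1)
      (cnt S (0 : Dual (ZMod 3) V) 2) = α * (m * m) + β * (m * (m * m)) := by
    have h1 : cnt S (0 : Dual (ZMod 3) V) 1 = 0 := by simp [cnt]
    have h2 : cnt S (0 : Dual (ZMod 3) V) 2 = 0 := by
      simp [cnt, show (0 : ZMod 3) ≠ 2 by decide]
    rw [h1, h2, rowStat_eq, sumSq_eq, tri_eq, show cnt S (0 : Dual (ZMod 3) V) 0 = m by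
      simpa [cnt] using hm]
    ring
  have hK : ∑ _f ∈ Finset.univ.erase (0 : Dual (ZMod 3) V), K + K = K * 3 ^ (n + 1) := by
    rw [Finset.sum_erase_add _ _ (Finset.mem_univ _), Finset.sum_const, Finset.card_univ,
      card_dual hn, smul_eq_mul, mul_comm]
  rw [← Finset.sum_erase_add _ _ (Finset.mem_univ (0 : Dual (ZMod 3) V)), hzero] at hsum
  intro f hf
  exact (key f hf).2 ((Finset.sum_eq_sum_iff_of_le hle).1
    (le_antisymm (Finset.sum_le_sum hle) (by omega)) f (Finset.mem_erase.2 ⟨hf, Finset.mem_univ _⟩))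

theorem TypesOK.false (hT : TypesOK S M noType) (hn : finrank (ZMod 3) V = n + 1) : False := by
  have hcard : 1 < Fintype.card (Dual (ZMod 3) V) := by
    rw [card_dual hn]
    exact Nat.one_lt_pow (by omega) (by omega)
  have := Fintype.one_lt_card_iff_nontrivial.1 hcard
  obtain ⟨f, hf⟩ := exists_ne (0 : Dual (ZMod 3) V)
  simpa [noType] using (ok_iff.1 (hT f hf)).2.2.2

theorem TypesOK.of_capBound (hM : CapBound n M) (hn : finrank (ZMod 3) V = n + 1)
    (hS : LineFree S) : TypesOK S M anyType := by
  intro f hf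
  have h : ∀ i, cnt S f i ≤ M := by
    intro i
    obtain ⟨v, S', hS', hcard, -⟩ := exists_slice hf S hS i
    rw [← hcard]
    exact hM _ (finrank_ker_dual hn hf) S' hS'
  exact ok_iff.2 ⟨h 0, h 1, h 2, rfl⟩

theorem CapBound.of_card_ne
    (h : ∀ (V : Type) [AddCommGroup V] [Module (ZMod 3) V] [Finite V],
      finrank (ZMod 3) V = n → ∀ S : Finset V, LineFree S → S.card ≠ M + 1) : CapBound n M := by
  intro V _ _ _ hn S hS
  by_contra! hlt
  obtain ⟨A, hA, hcard⟩ := Finset.exists_subset_card_eq (Nat.succ_le_of_lt hlt)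
  exact h V hn A (hS.mono hA) hcard

theorem CapBound.level (hM : CapBound n M) : Level (n + 1) M anyType :=
  fun _ _ _ _ hn _ hS => .of_capBound hM hn hS

theorem TypesOK.imp (hT : TypesOK S M t)
    (h : ∀ P Q, t S.card P Q = true → t' S.card P Q = true) : TypesOK S M t' := by
  intro f hf
  have h' := ok_iff.1 (hT f hf)
  refine ok_iff.2 ⟨h'.1, h'.2.1, h'.2.2.1, ?_⟩
  rw [cnt_add] at *
  exact h _ _ h'.2.2.2

end Steps

section Bounds

/-- The possible types of caps in dimension `3`: restricted only for nine points. -/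
def types3 (s P Q : ℕ) : Bool := Nat.blt s 9 || (isType 1 4 4 s P Q || isType 3 3 3 s P Q)

/-- The possible types of caps in dimension `4`: restricted only for at least `19` points. -/
def types4 (s P Q : ℕ) : Bool :=
  Nat.blt s 19 || (isType 2 9 9 s P Q || (isType 6 6 8 s P Q || (isType 1 9 9 s P Q ||
    (isType 2 8 9 s P Q || (isType 5 6 8 s P Q || isType 6 6 7 s P Q)))))

/-- The possible types of caps in dimension `5`: restricted only for `45` points. -/
def types5 (s P Q : ℕ) : Bool := Nat.blt s 45 || (isType 9 18 18 s P Q || isType 15 15 15 s P Q)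

variable {V : Type} [AddCommGroup V] [Module (ZMod 3) V] [Finite V] {S : Finset V}

theorem capBound_zero : CapBound 0 1 := by
  intro V _ _ _ hn S _
  have := Module.finrank_zero_iff.1 hn
  exact Finset.card_le_one_of_subsingleton S

theorem capBound_one : CapBound 1 2 := by
  refine .of_card_ne fun V _ _ _ hn S hS hm => ?_
  exact ((TypesOK.of_capBound capBound_zero hn hS).global (t' := noType) (α := 0) (β := 1) (K := 8)
    hn hS hm (by decide +kernel) (by norm_num)).false hn

theorem capBound_two : CapBound 2 4 := by
  refine .of_card_ne fun V _ _ _ hn S hS hm => ?_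
  exact ((TypesOK.of_capBound capBound_one hn hS).global (t' := noType) (α := 0) (β := 1) (K := 40)
    hn hS hm (by decide +kernel) (by norm_num)).false hn

theorem capBound_three : CapBound 3 9 := by
  refine .of_card_ne fun V _ _ _ hn S hS hm => ?_
  exact ((TypesOK.of_capBound capBound_two hn hS).global (t' := noType) (α := 0) (β := 1) (K := 327)
    hn hS hm (by decide +kernel) (by norm_num)).false hn

theorem level_three : Level 3 4 types3 := by
  intro V _ _ _ hn S hS
  have hT := TypesOK.of_capBound capBound_two hn hS
  rcases (capBound_three V hn S hS).lt_or_eq with hlt | hm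
  · exact hT.imp fun P Q _ => by simp [types3, hlt]
  · exact hT.global (α := 3) (β := 1) (K := 324) hn hS hm (by decide +kernel) (by norm_num)

/-- Certificates for row types of caps with `21` points in dimension `4`. -/
def rows4_21 : List RowCert :=
  [⟨9, 9, 3, ⟨-1, -1, -1, 0, 0, 0, 1, 8⟩⟩,
    ⟨9, 8, 4, ⟨0, -1, -1, 0, 0, 0, 0, -32⟩⟩,
    ⟨9, 7, 5, ⟨-1, -1, 0, 0, 0, 0, 0, -51⟩⟩,
    ⟨8, 8, 5, ⟨-1, 2, 2, 1, 1, 1, 1, 515⟩⟩,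
    ⟨9, 6, 6, ⟨-5, -3, 3, 0, 1, 1, 2, 185⟩⟩,
    ⟨8, 7, 6, ⟨-1, -1, -1, 0, 0, 0, 0, -60⟩⟩,
    ⟨7, 7, 7, ⟨-2, -2, -2, 0, 1, 1, 1, 207⟩⟩]

/-- Certificates for row types of caps with `20` points in dimension `4`. -/
def rows4_20 : List RowCert :=
  [⟨9, 8, 3, ⟨-6, 4, 6, -3, 1, -2, 6, -207⟩⟩,
    ⟨9, 7, 4, ⟨0, 0, -2, 0, 0, 0, 1, 63⟩⟩,
    ⟨8, 8, 4, ⟨10, 26, 36, 1, 4, 8, 25, 4150⟩⟩,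
    ⟨9, 6, 5, ⟨-8, 2, -1, -2, 1, 1, 2, -412⟩⟩,
    ⟨8, 7, 5, ⟨-2, 1, -2, 1, 0, 1, 1, 239⟩⟩,
    ⟨7, 7, 6, ⟨-2, -2, 0, 1, 1, 0, 1, 232⟩⟩]

/-- Certificates for row types of caps with `19` points in dimension `4`. -/
def rows4_19 : List RowCert :=
  [⟨9, 7, 3, ⟨-5, 4, 0, -2, 1, 0, 4, -194⟩⟩,
    ⟨9, 6, 4, ⟨-21, 5, 1, -7, 2, 1, 5, -1688⟩⟩,
    ⟨9, 5, 5, ⟨-9, -1, -3, -1, 2, 2, 2, -249⟩⟩]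

/-- The tight certificate for caps with `19` points in dimension `4`. -/
def row4 : RowCert := ⟨9, 9, 1, ⟨5, -3, 0, 1, -2, 0, 10, 81⟩⟩

/-- Certificates for row types of caps with `19` points in dimension `4`,
first round. -/
def rows4_19a : List RowCert :=
  [⟨8, 7, 4, ⟨9, 21, 28, 1, 3, 5, 25, 3191⟩⟩]

/-- Certificates for row types of caps with `19` points in dimension `4`,
second round. -/
def rows4_19b : List RowCert :=
  [⟨9, 8, 2, ⟨2, -3, 6, -1, 1, -2, 2, 16⟩⟩,
    ⟨8, 8, 3, ⟨0, 0, 0, 0, 0, -1, 0, -10⟩⟩,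
    ⟨7, 7, 5, ⟨-25, -25, -8, -10, -10, 1, -10, -4004⟩⟩]

/-- Certificates for row types of caps with `19` points in dimension `4`,
third round. -/
def rows4_19c : List RowCert :=
  [⟨8, 6, 5, ⟨0, 0, -1, 0, 1, 0, 0, 60⟩⟩,
    ⟨7, 6, 6, ⟨0, 0, 0, 0, 1, 1, 0, 142⟩⟩]

theorem capBound_four : CapBound 4 20 := by
  refine .of_card_ne fun V _ _ _ hn S hS hm => ?_
  have hT := (TypesOK.of_capBound capBound_three hn hS).without hn hS level_three (L := rows4_21)
    (by decide +kernel)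
  exact (hT.narrow (t' := noType) hm (by decide +kernel)).false hn

theorem typesOK_four_nineteen (hn : finrank (ZMod 3) V = 4) (hS : LineFree S)
    (hm : S.card = 19) : TypesOK S 9 types4 := by
  have hT := (TypesOK.of_capBound capBound_three hn hS).without hn hS level_three (L := rows4_19)
    (by decide +kernel)
  by_cases hrow : TypesOK S 9 (without (without anyType rows4_19) [row4])
  · have hT₁ := hrow.without hn hS level_three (L := rows4_19a) (by decide +kernel)
    have hT₂ := hT₁.without hn hS level_three (L := rows4_19b) (by decide +kernel)
    have hT₃ := hT₂.without hn hS level_three (L := rows4_19c) (by decide +kernel)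
    exact ((hT₃.narrow (t' := noType) hm (by decide +kernel)).false hn).elim
  · exact hT.of_row hn hS level_three (by decide +kernel) (by decide +kernel) (by decide +kernel)
      hrow

theorem level_four : Level 4 9 types4 := by
  intro V _ _ _ hn S hS
  have hT := TypesOK.of_capBound capBound_three hn hS
  have hle := capBound_four V hn S hS
  obtain hlt | hm | hm : S.card < 19 ∨ S.card = 19 ∨ S.card = 20 := by omega
  · exact hT.imp fun P Q _ => by simp [types4, hlt]
  · exact typesOK_four_nineteen hn hS hm
  · exact (hT.without hn hS level_three (L := rows4_20) (by decide +kernel)).narrow hm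
      (by decide +kernel)

/-- Certificates for row types of caps with `46` points in dimension `5`,
first round. -/
def rows5_46a : List RowCert :=
  [⟨20, 20, 6, ⟨-3, -3, 4, -1, -1, 0, 6, -1344⟩⟩,
    ⟨20, 19, 7, ⟨-4, 4, 4, -1, 0, 0, 5, 1739⟩⟩,
    ⟨20, 18, 8, ⟨-5, 8, 8, -1, 1, 1, 6, 5514⟩⟩,
    ⟨19, 19, 8, ⟨9, 8, 2, 1, 1, 0, 5, 11442⟩⟩,
    ⟨20, 17, 9, ⟨9, 9, 4, 1, 1, 1, 4, 10813⟩⟩,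
    ⟨19, 18, 9, ⟨0, 13, 16, 0, 2, 3, 6, 12592⟩⟩,
    ⟨20, 16, 10, ⟨-5, 3, 3, -1, 0, 0, 3, 189⟩⟩,
    ⟨19, 17, 10, ⟨22, 271, 265, 2, 36, 36, 102, 223225⟩⟩,
    ⟨20, 15, 11, ⟨-5, 2, 2, -1, 0, 0, 2, -925⟩⟩,
    ⟨19, 16, 11, ⟨1, 2, 3, 0, 0, 0, 2, 2633⟩⟩,
    ⟨18, 17, 11, ⟨51, 11, 35, 6, 1, 1, 20, 44159⟩⟩,
    ⟨20, 14, 12, ⟨-5, 2, 2, -1, 0, 0, 2, -890⟩⟩,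
    ⟨19, 15, 12, ⟨5, 8, 6, 0, 0, 0, 6, 8316⟩⟩,
    ⟨20, 13, 13, ⟨-98, 17, 26, -13, 2, 3, 11, -29601⟩⟩,
    ⟨19, 14, 13, ⟨6, 6, 4, 1, 0, 0, 5, 9336⟩⟩]

/-- Certificates for row types of caps with `46` points in dimension `5`,
second round. -/
def rows5_46b : List RowCert :=
  [⟨18, 18, 10, ⟨0, 0, 3, 0, 0, 0, 2, 2224⟩⟩,
    ⟨18, 16, 12, ⟨5, 2, 1, 1, 0, 0, 3, 6108⟩⟩,
    ⟨17, 17, 12, ⟨0, 0, -3, 1, 1, 0, 2, 5306⟩⟩,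
    ⟨18, 15, 13, ⟨0, 0, 1, 0, 0, 0, 1, 1205⟩⟩,
    ⟨17, 16, 13, ⟨-3, -2, -3, 0, 1, 1, 3, 4818⟩⟩,
    ⟨18, 14, 14, ⟨3, 5, 5, 0, 1, 1, 5, 8620⟩⟩,
    ⟨17, 15, 14, ⟨0, -5, 0, 1, 0, 1, 2, 4414⟩⟩,
    ⟨16, 16, 14, ⟨-3, -3, -3, 1, 1, 0, 2, 4231⟩⟩,
    ⟨16, 15, 15, ⟨6, 2, 2, 1, 1, 1, 6, 11474⟩⟩]

theorem capBound_five : CapBound 5 45 := by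
  refine .of_card_ne fun V _ _ _ hn S hS hm => ?_
  have hT := (TypesOK.of_capBound capBound_four hn hS).without hn hS level_four (L := rows5_46a)
    (by decide +kernel)
  have hT' := hT.without hn hS level_four (L := rows5_46b) (by decide +kernel)
  exact (hT'.narrow (t' := noType) hm (by decide +kernel)).false hn

/-- Certificates for row types of caps with `45` points in dimension `5`,
first round. -/
def rows5_45a : List RowCert :=
  [⟨20, 20, 5, ⟨-9, -9, 8, -2, -2, -1, 9, -7138⟩⟩,
    ⟨20, 19, 6, ⟨-3, 4, 6, -1, 0, 0, 6, 2018⟩⟩,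
    ⟨20, 18, 7, ⟨21, 11, 9, 2, 1, 1, 7, 17476⟩⟩,
    ⟨19, 19, 7, ⟨4, 4, 5, 0, 0, 0, 5, 5251⟩⟩,
    ⟨20, 17, 8, ⟨80, 65, 47, 9, 7, 8, 30, 82236⟩⟩,
    ⟨20, 16, 9, ⟨-25, 24, 22, -5, 2, 3, 17, 5639⟩⟩,
    ⟨20, 15, 10, ⟨-36, 26, 4, -5, 2, 0, 9, -4922⟩⟩,
    ⟨20, 14, 11, ⟨-6, 3, 3, -1, 0, 0, 3, -111⟩⟩,
    ⟨19, 15, 11, ⟨3, 11, 16, -1, 0, 0, 10, 10001⟩⟩,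
    ⟨20, 13, 12, ⟨-182, 42, 31, -24, 4, 4, 19, -60027⟩⟩,
    ⟨19, 14, 12, ⟨1, 3, 3, 0, 0, 0, 2, 2590⟩⟩]

/-- Certificates for row types of caps with `45` points in dimension `5`,
second round. -/
def rows5_45b : List RowCert :=
  [⟨19, 18, 8, ⟨1, 57, 48, -1, 6, 6, 27, 42325⟩⟩,
    ⟨19, 17, 9, ⟨35, 222, 126, -5, 19, 8, 105, 152528⟩⟩,
    ⟨19, 16, 10, ⟨10, 8, 14, 1, 0, 0, 9, 13738⟩⟩,
    ⟨18, 16, 11, ⟨719, 307, 579, 87, 31, 61, 322, 706303⟩⟩,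
    ⟨17, 17, 11, ⟨9, 9, 9, 1, 1, 1, 6, 12174⟩⟩,
    ⟨19, 13, 13, ⟨9, 7, 7, 1, 0, 0, 6, 10567⟩⟩]

/-- Certificates for row types of caps with `45` points in dimension `5`,
third round. -/
def rows5_45c : List RowCert :=
  [⟨18, 17, 10, ⟨11, 10, 8, 1, 1, 1, 7, 13469⟩⟩,
    ⟨18, 15, 12, ⟨98, 16, 82, 11, 2, 9, 44, 92001⟩⟩,
    ⟨17, 16, 12, ⟨14, 8, 13, 2, 1, 1, 9, 17617⟩⟩,
    ⟨18, 14, 13, ⟨14, 9, 9, 2, 1, 1, 9, 17898⟩⟩,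
    ⟨17, 15, 13, ⟨8, 9, 8, 1, 1, 1, 7, 13082⟩⟩,
    ⟨16, 16, 13, ⟨8, 8, 8, 1, 1, 1, 5, 10829⟩⟩,
    ⟨17, 14, 14, ⟨9, 9, 9, 1, 1, 1, 6, 12174⟩⟩,
    ⟨16, 15, 14, ⟨9, 11, 8, 1, 1, 1, 8, 14434⟩⟩]

theorem level_five : Level 5 20 types5 := by
  intro V _ _ _ hn S hS
  have hT := TypesOK.of_capBound capBound_four hn hS
  rcases (capBound_five V hn S hS).lt_or_eq with hlt | hm
  · exact hT.imp fun P Q _ => by simp [types5, hlt]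
  · have hT₁ := hT.without hn hS level_four (L := rows5_45a) (by decide +kernel)
    have hT₂ := hT₁.without hn hS level_four (L := rows5_45b) (by decide +kernel)
    have hT₃ := hT₂.without hn hS level_four (L := rows5_45c) (by decide +kernel)
    exact hT₃.narrow hm (by decide +kernel)

/-- Certificates for row types of caps with `113` points in dimension `6`. -/
def rows6_113 : List RowCert :=
  [⟨45, 45, 23, ⟨-5, -9, 0, -1, -1, 0, 1, -54705⟩⟩,
    ⟨45, 44, 24, ⟨-80, 16, 12, -10, 1, 0, 5, -237580⟩⟩]

theorem capBound_six : CapBound 6 112 := by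
  refine .of_card_ne fun V _ _ _ hn S hS hm => ?_
  have hT := (TypesOK.of_capBound capBound_five hn hS).without hn hS level_five (L := rows6_113)
    (by decide +kernel)
  exact (hT.global (t' := noType) (α := 19) (β := 1) (K := 561835) hn hS hm (by decide +kernel)
    (by norm_num)).false hn

/-- Certificates for row types of caps with `289` points in dimension `7`,
first round. -/
def rows7_289a : List RowCert :=
  [⟨112, 112, 65, ⟨164, 164, 66, 5, 5, 0, 15, 10224368⟩⟩]

/-- Certificates for row types of caps with `289` points in dimension `7`,
second round. -/
def rows7_289b : List RowCert :=
  [⟨112, 111, 66, ⟨222, 204, 91, 7, 6, 0, 20, 13381654⟩⟩]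

/-- Certificates for row types of caps with `289` points in dimension `7`,
third round. -/
def rows7_289c : List RowCert :=
  [⟨112, 110, 67, ⟨121, 101, 48, 4, 3, 0, 10, 6940899⟩⟩]

/-- Certificates for row types of caps with `289` points in dimension `7`,
fourth round. -/
def rows7_289d : List RowCert :=
  [⟨111, 111, 67, ⟨32, 32, 14, 1, 1, 0, 3, 2021023⟩⟩]

set_option maxHeartbeats 4000000 in
theorem capBound_seven : CapBound 7 288 := by
  refine .of_card_ne fun V _ _ _ hn S hS hm => ?_
  have hL := capBound_five.level
  have hT := (TypesOK.of_capBound capBound_six hn hS).without hn hS hL (L := rows7_289a)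
    (by decide +kernel)
  have hT₁ := hT.without hn hS hL (L := rows7_289b) (by decide +kernel)
  have hT₂ := hT₁.without hn hS hL (L := rows7_289c) (by decide +kernel)
  have hT₃ := hT₂.without hn hS hL (L := rows7_289d) (by decide +kernel)
  exact (hT₃.global (t' := noType) (α := 43) (β := 1) (K := 9243019) hn hS hm (by decide +kernel)
    (by norm_num)).false hn

lemma IsCap.lineFree {n : ℕ} {S : Finset (Fin n → ZMod 3)} (hS : IsCap S) : LineFree S := by
  have key : ∀ x y z : Fin n → ZMod 3, x + y + z = 0 → x = y → y = z := by
    intro x y z h hxy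
    subst hxy
    funext i
    have hi := congrFun h i
    simp only [Pi.add_apply, Pi.zero_apply] at hi
    generalize x i = a at hi ⊢
    generalize z i = b at hi ⊢
    revert a b
    decide
  intro x hx y hy z hz h
  by_cases hxy : x = y
  · exact ⟨hxy, key x y z h hxy⟩
  by_cases hyz : y = z
  · have := key y z x (by rw [← h]; abel) hyz
    exact absurd (hyz.trans this).symm hxy
  by_cases hxz : x = z
  · exact absurd (key x z y (by rw [← h]; abel) hxz).symm hyz
  · exact absurd h (hS x hx y hy z hz hxy hxz hyz)

end Bounds

end CapBounds

/-- Every cap in dimension 7 has size at most 288; there are no 289-cap 7-flats. -/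
theorem no_289_cap_7_flat (S : Finset (Fin 7 → ZMod 3)) (hS : IsCap S) :
    S.card ≤ 288 := by
  exact capBound_seven _ (by simp) S hS.lineFree
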